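/- For a finite simplicial complex K and any n ≥ 2, the n-th symmetric simplicial complexity equals the n-th symmetric topological complexity of the geometric realization: SC^Σ_n(K) = TC^Σ_n(|K|). -/

import Mathlib

noncomputable section
open scoped ENat
attribute [local instance] Classical.propDecidable

universe u v

/-! ### The wedge `I_n` of `n` unit intervals glued at `0` -/

def wedgeSetoid (n : ℕ) : Setoid (Fin n × unitInterval) where
  r p q := p = q ∨ (p.2 = 0 ∧ q.2 = 0)
  iseqv := by
    refine ⟨fun _ => Or.inl rfl, ?_, ?_⟩
    · rintro p q (rfl | ⟨h1, h2⟩)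
      · exact Or.inl rfl
      · exact Or.inr ⟨h2, h1⟩
    · rintro p q s (rfl | ⟨h1, h2⟩) h
      · exact h
      · rcases h with rfl | ⟨h3, h4⟩
        · exact Or.inr ⟨h1, h2⟩
        · exact Or.inr ⟨h1, h4⟩

def WedgeI (n : ℕ) : Type := Quotient (wedgeSetoid n)

instance (n : ℕ) : TopologicalSpace (WedgeI n) := by unfold WedgeI; infer_instance

/-- the point `t_j` on the `j`-th arm of `I_n`. -/
def arm (n : ℕ) (j : Fin n) (t : unitInterval) : WedgeI n :=
  Quotient.mk (wedgeSetoid n) (j, t)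

/-- The `n`-th symmetric topological complexity `TC^Σ_n(X)`:  the equivariant sectional
category of the fibration `e_n : X^{I_n} → X^n`. -/
def TCSigma (n : ℕ) (X : Type v) [TopologicalSpace X] : ℕ∞ :=
  sInf {k : ℕ∞ | ∃ k0 : ℕ, k = (k0 : ℕ∞) ∧
    ∃ U : Fin k0 → Set (Fin n → X),
      (∀ i, IsOpen (U i)) ∧
      (∀ x, ∃ i, x ∈ U i) ∧
      (∀ i (g : Equiv.Perm (Fin n)), ∀ x ∈ U i, (fun j => x (g j)) ∈ U i) ∧
      ∀ i, ∃ s : C(↥(U i), C(WedgeI n, X)),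
        (∀ (x : ↥(U i)) (j : Fin n), (s x) (arm n j 1) = x.1 j) ∧
        ∀ (g : Equiv.Perm (Fin n)) (x : Fin n → X) (hx : x ∈ U i)
          (hgx : (fun j => x (g j)) ∈ U i) (t : unitInterval) (j : Fin n),
          (s ⟨fun j => x (g j), hgx⟩) (arm n j t) = (s ⟨x, hx⟩) (arm n (g j) t)}

/-! ### Abstract simplicial complexes, simplicial maps and contiguity -/

structure ASC (V : Type u) where
  faces : Set (Finset V)
  nonempty_of_mem : ∀ {σ : Finset V}, σ ∈ faces → σ.Nonempty
  down_closed : ∀ {σ τ : Finset V}, σ ∈ faces → τ ⊆ σ → τ.Nonempty → τ ∈ faces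

def IsSimplicialMap {V : Type u} {W : Type v} (K : ASC V) (L : ASC W) (f : V → W) : Prop :=
  ∀ σ ∈ K.faces, σ.image f ∈ L.faces

/-- one-step contiguity (of simplicial maps). -/
def OneCont {V : Type u} {W : Type v} (K : ASC V) (L : ASC W) (f g : V → W) : Prop :=
  IsSimplicialMap K L f ∧ IsSimplicialMap K L g ∧
    ∀ σ ∈ K.faces, σ.image f ∪ σ.image g ∈ L.faces

/-- `c`-contiguity. -/
def Contig {V : Type u} {W : Type v} (K : ASC V) (L : ASC W) (c : ℕ) (f g : V → W) : Prop :=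
  ∃ φ : ℕ → V → W, φ 0 = f ∧ φ c = g ∧ ∀ i < c, OneCont K L (φ i) (φ (i + 1))

/-- `v` is a vertex of `K`. -/
def vertexOf {V : Type u} (K : ASC V) (v : V) : Prop := {v} ∈ K.faces

/-- Symmetric contiguity of the family `f_1, …, f_n : K → L` relative to an action `act` of
`Σ_n` on the vertices of `K`. -/
def SymContiguousOn {V : Type u} {W : Type v} (n : ℕ) (act : Equiv.Perm (Fin n) → V → V)
    (K : ASC V) (L : ASC W) (f : Fin n → V → W) : Prop :=
  (∀ (j : Fin n) (g : Equiv.Perm (Fin n)) (v : V), vertexOf K v → f j (act g v) = f (g j) v) ∧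
  ∃ (c : ℕ) (φ : Fin n → ℕ → V → W), 0 < c ∧
    (∀ j j', φ j 0 = φ j' 0) ∧
    (∀ (j : Fin n) (g : Equiv.Perm (Fin n)) (v : V), vertexOf K v → φ j 0 (act g v) = φ j 0 v) ∧
    (∀ j, φ j c = f j) ∧
    (∀ j l, l < c → OneCont K L (φ j l) (φ j (l + 1))) ∧
    (∀ (j : Fin n) (l : ℕ) (g : Equiv.Perm (Fin n)) (v : V),
      vertexOf K v → l ≤ c → φ j l (act g v) = φ (g j) l v)
/-! ### Geometric realization -/

def ASC.realization {V : Type u} [Fintype V] (K : ASC V) : Set (V → ℝ) :=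
  {α | (∀ v, 0 ≤ α v) ∧ (∑ v, α v) = 1 ∧ ∃ σ ∈ K.faces, ∀ v, α v ≠ 0 → v ∈ σ}

/-- the open star of a vertex in the realization. -/
def ASC.star {V : Type u} [Fintype V] (K : ASC V) (v : V) : Set (V → ℝ) :=
  {α | α ∈ K.realization ∧ α v ≠ 0}

/-- realization of a vertex map (pushforward of weights). -/
def realizeMap {V : Type u} {W : Type v} [Fintype V] (f : V → W) (α : V → ℝ) : W → ℝ :=
  fun w => ∑ v ∈ Finset.univ.filter (fun v => f v = w), α v

/-! ### Barycentric subdivision of a simplicial complex -/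

/-- the barycentric subdivision: vertices are the simplices of `K`, simplices are chains. -/
def sdC {W : Type u} (K : ASC W) : ASC (Finset W) where
  faces := {c | c.Nonempty ∧ (∀ σ ∈ c, σ ∈ K.faces) ∧ IsChain (· ⊆ ·) (c : Set (Finset W))}
  nonempty_of_mem h := h.1
  down_closed := by
    intro σ τ hσ hsub hne
    exact ⟨hne, fun x hx => hσ.2.1 x (hsub hx), hσ.2.2.mono (Finset.coe_subset.mpr hsub)⟩

/-- the canonical linear map `|sd K| → |K|` sending the vertex `σ` to the barycenter of `σ`. -/
def stepReal (W : Type u) [Fintype W] (β : Finset W → ℝ) : W → ℝ :=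
  fun w => ∑ σ : Finset W, β σ * (if w ∈ σ then ((σ.card : ℝ))⁻¹ else 0)

/-! ### Order complexes, products, lower-set (Alexandrov) topologies -/

/-- the order complex of a poset: simplices are finite nonempty chains. -/
def OC (P : Type u) [Preorder P] : ASC P where
  faces := {σ | σ.Nonempty ∧ IsChain (· ≤ ·) (σ : Set P)}
  nonempty_of_mem h := h.1
  down_closed := by
    intro σ τ hσ hsub hne
    exact ⟨hne, hσ.2.mono (Finset.coe_subset.mpr hsub)⟩

/-- the `n`-fold ordered cartesian product `K^n` of an ordered simplicial complex. -/
def powC {V : Type u} [PartialOrder V] (K : ASC V) (n : ℕ) : ASC (Fin n → V) where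
  faces := {S | S.Nonempty ∧ IsChain (· ≤ ·) (S : Set (Fin n → V)) ∧
    ∀ j, S.image (fun x => x j) ∈ K.faces}
  nonempty_of_mem h := h.1
  down_closed := by
    intro S T hS hsub hne
    refine ⟨hne, hS.2.1.mono (Finset.coe_subset.mpr hsub), fun j => ?_⟩
    exact K.down_closed (hS.2.2 j) (Finset.image_subset_image hsub) (hne.image _)

/-- The Alexandrov topology associated to a relation: open sets are the down-sets. -/
def lowTop (α : Type u) (le : α → α → Prop) : TopologicalSpace α where
  IsOpen U := ∀ a ∈ U, ∀ b, le b a → b ∈ U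
  isOpen_univ := fun _ _ _ _ => trivial
  isOpen_inter := fun U V hU hV a ha b hb => ⟨hU a ha.1 b hb, hV a ha.2 b hb⟩
  isOpen_sUnion := by
    intro S hS a ha b hb
    obtain ⟨U, hUS, haU⟩ := ha
    exact ⟨U, hUS, hS U hUS a haU b hb⟩

/-- product topology, with an explicitly given topology on the first factor. -/
def prodTop (P : Type u) (lp : TopologicalSpace P) (Y : Type v) [ty : TopologicalSpace Y] :
    TopologicalSpace (P × Y) := @instTopologicalSpaceProd P Y lp ty
/-! ### The finite "wedge of fences" poset `J_{n,m}` -/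

/-- `J_{n,m}`: `none` is the common basepoint `0`, `some (j, i)` is the point `(i+1)_j`
on the `j`-th fence. -/
abbrev JP (n m : ℕ) : Type := Option (Fin n × Fin m)

/-- the zigzag (fence) order on values `0,1,2,…`:  `e ≤ o` when `e` is even, `o` odd and
they are adjacent. -/
def fLE (a b : ℕ) : Prop := a = b ∨ (a % 2 = 0 ∧ b % 2 = 1 ∧ (b = a + 1 ∨ a = b + 1))

/-- the order relation on `J_{n,m}`. -/
def JLE {n m : ℕ} : JP n m → JP n m → Prop
  | none, none => True
  | none, some q => fLE 0 (q.2.1 + 1)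
  | some p, none => fLE (p.2.1 + 1) 0
  | some p, some q => p.1 = q.1 ∧ fLE (p.2.1 + 1) (q.2.1 + 1)

/-- the end point `m_j` of the `j`-th fence. -/
def endPt (n m : ℕ) (j : Fin n) : JP n m :=
  if h : 0 < m then some (j, ⟨m - 1, by omega⟩) else none

/-- the action of `Σ_n` on `J_{n,m}` permuting the fences. -/
def jAct {n m : ℕ} (g : Equiv.Perm (Fin n)) : JP n m → JP n m :=
  Option.map (fun p => (g p.1, p.2))

/-- order-preserving maps out of `J_{n,m}`. -/
def JMono {n m : ℕ} {P : Type u} [Preorder P] (γ : JP n m → P) : Prop :=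
  ∀ a b, JLE a b → γ a ≤ γ b

/-! ### Iterated barycentric subdivisions (concrete model) -/

/-- `SdT V r` is the `r`-fold iterated `Finset` of `V`: the potential vertices of the `r`-fold
barycentric subdivision. -/
def SdT (V : Type u) : ℕ → Type u
  | 0 => V
  | r + 1 => Finset (SdT V r)

/-- the order on `SdT`: the given relation at level `0`, inclusion at higher levels. -/
def SdLE (V : Type u) (le0 : V → V → Prop) : (r : ℕ) → SdT V r → SdT V r → Prop
  | 0 => le0
  | r + 1 => fun (a b : Finset (SdT V r)) => a ⊆ b

/-- elements of `SdT V r` which are genuine iterated chains, i.e. points of `sd^r`. -/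
def SdOK (V : Type u) (le0 : V → V → Prop) : (r : ℕ) → SdT V r → Prop
  | 0 => fun _ => True
  | r + 1 => fun (c : Finset (SdT V r)) =>
      c.Nonempty ∧ (∀ x ∈ c, SdOK V le0 r x) ∧
      ∀ x ∈ c, ∀ y ∈ c, SdLE V le0 r x y ∨ SdLE V le0 r y x

/-- functorial lift of a self map to iterated subdivisions. -/
def SdMap (V : Type u) (f : V → V) : (r : ℕ) → SdT V r → SdT V r
  | 0 => f
  | r + 1 => fun (c : Finset (SdT V r)) => c.image (SdMap V f r)

instance sdNonempty (V : Type u) [Nonempty V] : ∀ r, Nonempty (SdT V r)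
  | 0 => ‹Nonempty V›
  | r + 1 => ⟨(∅ : Finset (SdT V r))⟩

instance sdFintype (V : Type u) [Fintype V] : ∀ r, Fintype (SdT V r)
  | 0 => ‹Fintype V›
  | r + 1 => letI := sdFintype V r; inferInstanceAs (Fintype (Finset (SdT V r)))

/-- the greatest element of a finite set w.r.t. a relation (junk value if there is none). -/
def grIn {α : Type u} [Nonempty α] (le : α → α → Prop) (c : Finset α) : α :=
  if h : ∃ x, x ∈ c ∧ ∀ y ∈ c, le y x then h.choose else Classical.arbitrary α

/-- the iterated "last element" map `τ^r : sd^r(P) → P`. -/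
def SdTau (V : Type u) [Nonempty V] (le0 : V → V → Prop) : (r : ℕ) → SdT V r → V
  | 0 => fun x => x
  | r + 1 => fun (c : Finset (SdT V r)) => SdTau V le0 r (grIn (SdLE V le0 r) c)

/-- the permutation action on `P^n`. -/
def pAct {X : Type u} {n : ℕ} (g : Equiv.Perm (Fin n)) (x : Fin n → X) : Fin n → X :=
  fun j => x (g j)

/-- open subsets of `sd^r` (in its Alexandrov topology), as sets of iterated chains. -/
def SdOpen (X : Type u) (le0 : X → X → Prop) (r : ℕ) (U : Set (SdT X r)) : Prop :=
  (∀ x ∈ U, SdOK X le0 r x) ∧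
  ∀ a ∈ U, ∀ b, SdOK X le0 r b → SdLE X le0 r b a → b ∈ U

/-! ### Higher symmetric combinatorial complexity -/

/-- `CC^{Σ,r}_{n,m}(P) ≤ k`. -/
def CCle (P : Type u) [PartialOrder P] [Nonempty P] (n m r k : ℕ) : Prop :=
  ∃ U : Fin k → Set (SdT (Fin n → P) r),
    (∀ i, SdOpen (Fin n → P) (· ≤ ·) r (U i)) ∧
    (∀ x, SdOK (Fin n → P) (· ≤ ·) r x → ∃ i, x ∈ U i) ∧
    (∀ i (g : Equiv.Perm (Fin n)), ∀ x ∈ U i, SdMap (Fin n → P) (pAct g) r x ∈ U i) ∧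
    (∀ i, ∃ s : SdT (Fin n → P) r → JP n m → P,
      (∀ x ∈ U i, JMono (s x)) ∧
      (∀ x ∈ U i, ∀ y ∈ U i, SdLE (Fin n → P) (· ≤ ·) r x y → ∀ t, s x t ≤ s y t) ∧
      (∀ (g : Equiv.Perm (Fin n)), ∀ x ∈ U i, ∀ t, s (SdMap (Fin n → P) (pAct g) r x) t = s x (jAct g t)) ∧
      (∀ x ∈ U i, ∀ j : Fin n, s x (endPt n m j) = SdTau (Fin n → P) (· ≤ ·) r x j))

/-- the value `CC^{Σ,r}_{n,m}(P)` (`∞` if there is no such cover). -/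
def CCnm (P : Type u) [PartialOrder P] [Nonempty P] (n m r : ℕ) : ℕ∞ :=
  sInf {k : ℕ∞ | ∃ k0 : ℕ, k = (k0 : ℕ∞) ∧ CCle P n m r k0}

/-- the stable value `CC^{Σ,r}_n(P)` (minimum over all fence lengths `m`). -/
def CCr (P : Type u) [PartialOrder P] [Nonempty P] (n r : ℕ) : ℕ∞ :=
  sInf {k : ℕ∞ | ∃ k0 m : ℕ, k = (k0 : ℕ∞) ∧ CCle P n m r k0}
/-! ### Iterated barycentric subdivision of a simplicial complex, and `SC^{Σ,r}_n` -/

/-- the `r`-fold barycentric subdivision `sd^r(K)`. -/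
def CIter {V : Type u} (K : ASC V) : (r : ℕ) → ASC (SdT V r)
  | 0 => K
  | r + 1 => sdC (CIter K r)

/-- the iterated linear map `|sd^r K| → |K|`. -/
def iterReal (V : Type u) [Fintype V] : (r : ℕ) → (SdT V r → ℝ) → (V → ℝ)
  | 0 => fun α => α
  | r + 1 => fun (β : Finset (SdT V r) → ℝ) => iterReal V r (stepReal (SdT V r) β)

/-- composition of the chosen one-step approximations `ι : sd^{s+1} → sd^s`, giving
`ι^r : sd^r(K^n) → K^n`. -/
def compIota {V' : Type u} (ιs : (s : ℕ) → Finset (SdT V' s) → SdT V' s) :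
    (r : ℕ) → SdT V' r → V'
  | 0 => fun x => x
  | r + 1 => fun (x : Finset (SdT V' r)) => compIota ιs r (ιs r x)

/-- the family `ιs` consists, up to level `r`, of `Σ_n`-equivariant simplicial approximations
of the identity of `|K^n|`. -/
def GoodIota {V : Type u} [Fintype V] [PartialOrder V] (K : ASC V) (n r : ℕ)
    (ιs : (s : ℕ) → Finset (SdT (Fin n → V) s) → SdT (Fin n → V) s) : Prop :=
  ∀ s, s < r →
    IsSimplicialMap (CIter (powC K n) (s + 1)) (CIter (powC K n) s) (ιs s) ∧
    (∀ (v : SdT (Fin n → V) (s + 1)), ∀ α ∈ (CIter (powC K n) (s + 1)).star v,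
      stepReal (SdT (Fin n → V) s) α ∈ (CIter (powC K n) s).star (ιs s v)) ∧
    (∀ (g : Equiv.Perm (Fin n)) (σ : SdT (Fin n → V) (s + 1)),
      ιs s (SdMap (Fin n → V) (pAct g) (s + 1) σ) = SdMap (Fin n → V) (pAct g) s (ιs s σ))

/-- `SC^{Σ,r}_n(K) ≤ k` (with respect to the chosen approximations `ιs`). -/
def SCle {V : Type u} [Fintype V] [PartialOrder V] (K : ASC V) (n r : ℕ)
    (ιs : (s : ℕ) → Finset (SdT (Fin n → V) s) → SdT (Fin n → V) s) (k : ℕ) : Prop :=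
  ∃ L : Fin k → ASC (SdT (Fin n → V) r),
    (∀ i, (L i).faces ⊆ (CIter (powC K n) r).faces) ∧
    (∀ σ ∈ (CIter (powC K n) r).faces, ∃ i, σ ∈ (L i).faces) ∧
    (∀ i (g : Equiv.Perm (Fin n)), ∀ σ ∈ (L i).faces,
      σ.image (SdMap (Fin n → V) (pAct g) r) ∈ (L i).faces) ∧
    (∀ i, SymContiguousOn n (fun g => SdMap (Fin n → V) (pAct g) r) (L i) K
      (fun j x => compIota ιs r x j))

/-- the value `SC^{Σ,r}_n(K)` with respect to the chosen approximations `ιs`. -/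
def SCval {V : Type u} [Fintype V] [PartialOrder V] (K : ASC V) (n r : ℕ)
    (ιs : (s : ℕ) → Finset (SdT (Fin n → V) s) → SdT (Fin n → V) s) : ℕ∞ :=
  sInf {k : ℕ∞ | ∃ k0 : ℕ, k = (k0 : ℕ∞) ∧ SCle K n r ιs k0}
/-! ### Helper lemmas: lengths of disjoint unions of intervals -/

lemma sumLen_eq {ι : Type*} (s : Finset ι) (a b : ι → ℝ) (A B : ℝ) (hAB : A ≤ B)
    (hc : ∀ t, t ∈ Set.Ioc A B ↔ ∃ i ∈ s, t ∈ Set.Ioc (a i) (b i))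
    (hd : ∀ i ∈ s, ∀ i' ∈ s, ∀ t, t ∈ Set.Ioc (a i) (b i) → t ∈ Set.Ioc (a i') (b i') → i = i') :
    ∑ i ∈ s, max 0 (b i - a i) = B - A := by
  have h1 : Set.Ioc A B = ⋃ i ∈ s, Set.Ioc (a i) (b i) := by
    ext t; rw [hc]; simp only [Set.mem_iUnion, exists_prop]
  have h2 : MeasureTheory.volume.real (⋃ i ∈ s, Set.Ioc (a i) (b i)) =
      ∑ i ∈ s, MeasureTheory.volume.real (Set.Ioc (a i) (b i)) := by
    apply MeasureTheory.measureReal_biUnion_finset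
    · intro i hi i' hi' hne
      rw [Function.onFun, Set.disjoint_left]
      intro t ht ht'
      exact hne (hd i hi i' hi' t ht ht')
    · intro i _; exact measurableSet_Ioc
    · intro i _; exact measure_Ioc_lt_top.ne
  rw [← h1, Real.volume_real_Ioc, max_eq_left (by linarith)] at h2
  rw [h2]
  refine Finset.sum_congr rfl fun i _ => ?_
  rw [Real.volume_real_Ioc, max_comm]

lemma continuous_foldMin {X ι : Type*} [TopologicalSpace X] (s : Finset ι) (f : ι → X → ℝ)
    (hf : ∀ i, Continuous (f i)) (b : ℝ) : Continuous fun x => s.fold min b (fun i => f i x) := by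
  induction s using Finset.induction_on with
  | empty => simpa using continuous_const
  | insert a s ha ih =>
    simp only [Finset.fold_insert ha]
    exact (hf a).min ih

lemma continuous_foldMax {X ι : Type*} [TopologicalSpace X] (s : Finset ι) (f : ι → X → ℝ)
    (hf : ∀ i, Continuous (f i)) (b : ℝ) : Continuous fun x => s.fold max b (fun i => f i x) := by
  induction s using Finset.induction_on with
  | empty => simpa using continuous_const
  | insert a s ha ih =>
    simp only [Finset.fold_insert ha]
    exact (hf a).max ih

lemma real_le_one {W : Type u} [Fintype W] {K : ASC W} {α : W → ℝ} (h : α ∈ K.realization)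
    (v : W) : α v ≤ 1 := by
  rw [← h.2.1]
  exact Finset.single_le_sum (fun i _ => h.1 i) (Finset.mem_univ v)

lemma real_supp_face {W : Type u} [Fintype W] {K : ASC W} {α : W → ℝ} (h : α ∈ K.realization) :
    Finset.univ.filter (fun v => α v ≠ 0) ∈ K.faces := by
  obtain ⟨h0, h1, σ, hσ, hs⟩ := h
  refine K.down_closed hσ (fun v hv => hs v (by simpa using hv)) ?_
  by_contra hne
  rw [Finset.not_nonempty_iff_eq_empty, Finset.filter_eq_empty_iff] at hne
  have : ∑ v, α v = 0 := Finset.sum_eq_zero fun v hv => by simpa using hne hv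
  rw [h1] at this; norm_num at this

/-! ### The continuous section of `|sd K| → |K|` -/

def loS {W : Type u} [Fintype W] (α : W → ℝ) (σ : Finset W) : ℝ := (σᶜ).fold max 0 α
def hiS {W : Type u} (α : W → ℝ) (σ : Finset W) : ℝ := σ.fold min 1 α

def secStep {W : Type u} [Fintype W] (α : W → ℝ) (σ : Finset W) : ℝ :=
  (σ.card : ℝ) * max 0 (hiS α σ - loS α σ)

lemma continuous_secStep {W : Type u} [Fintype W] :
    Continuous (secStep : (W → ℝ) → (Finset W → ℝ)) := by
  refine continuous_pi fun σ => ?_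
  unfold secStep hiS loS
  refine continuous_const.mul (continuous_const.max (Continuous.sub ?_ ?_))
  · exact continuous_foldMin _ (fun i (x : W → ℝ) => x i) (fun i => continuous_apply i) _
  · exact continuous_foldMax _ (fun i (x : W → ℝ) => x i) (fun i => continuous_apply i) _

lemma mem_gap_iff {W : Type u} [Fintype W] (α : W → ℝ) (σ : Finset W) (t : ℝ) :
    t ∈ Set.Ioc (loS α σ) (hiS α σ) ↔ 0 < t ∧ t ≤ 1 ∧ ∀ v, v ∈ σ ↔ t ≤ α v := by
  unfold loS hiS
  rw [Set.mem_Ioc, Finset.fold_max_lt, Finset.le_fold_min]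
  constructor
  · rintro ⟨⟨h1, h2⟩, h3, h4⟩
    refine ⟨h1, h3, fun v => ⟨h4 v, fun h => ?_⟩⟩
    by_contra hv
    exact absurd (h2 v (by simpa using hv)) (not_lt.mpr h)
  · rintro ⟨h1, h2, h3⟩
    refine ⟨⟨h1, fun v hv => ?_⟩, h2, fun v hv => (h3 v).1 hv⟩
    rw [Finset.mem_compl, h3] at hv
    exact not_le.mp hv

lemma gap_pos {W : Type u} [Fintype W] {α : W → ℝ} {σ : Finset W} (h : secStep α σ ≠ 0) :
    σ.Nonempty ∧ ∃ t, 0 < t ∧ t ≤ 1 ∧ ∀ v, v ∈ σ ↔ t ≤ α v := by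
  unfold secStep at h
  have h1 : σ.card ≠ 0 := fun h0 => h (by simp [h0])
  have h2 : 0 < hiS α σ - loS α σ := by
    by_contra hh
    exact h (by rw [max_eq_left (not_lt.mp hh), mul_zero])
  refine ⟨Finset.card_ne_zero.mp h1, hiS α σ, (mem_gap_iff α σ _).1 ⟨by linarith, le_rfl⟩⟩

lemma sum_gap {W : Type u} [Fintype W] {α : W → ℝ} (h0 : ∀ v, 0 ≤ α v) (h1 : ∀ v, α v ≤ 1)
    (w : W) : ∑ σ ∈ Finset.univ.filter (fun σ : Finset W => w ∈ σ),
      max 0 (hiS α σ - loS α σ) = α w := by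
  have := sumLen_eq (Finset.univ.filter (fun σ : Finset W => w ∈ σ)) (loS α) (hiS α) 0 (α w) (h0 w)
    (by
      intro t
      constructor
      · rintro ⟨ht, ht'⟩
        refine ⟨Finset.univ.filter (fun v => t ≤ α v), by simpa using ht', ?_⟩
        rw [mem_gap_iff]
        exact ⟨ht, ht'.trans (h1 w), fun v => by simp⟩
      · rintro ⟨σ, hσ, ht⟩
        rw [mem_gap_iff] at ht
        exact ⟨ht.1, (ht.2.2 w).1 (by simpa using hσ)⟩)
    (by
      intro σ _ τ _ t h h'
      rw [mem_gap_iff] at h h'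
      ext v
      rw [h.2.2, h'.2.2])
  rw [this, sub_zero]

lemma stepReal_secStep {W : Type u} [Fintype W] {α : W → ℝ} (h0 : ∀ v, 0 ≤ α v)
    (h1 : ∀ v, α v ≤ 1) : stepReal W (secStep α) = α := by
  funext w
  rw [← sum_gap h0 h1 w]
  unfold stepReal
  rw [Finset.sum_filter]
  refine Finset.sum_congr rfl fun σ _ => ?_
  unfold secStep
  by_cases hw : w ∈ σ
  · have : (σ.card : ℝ) ≠ 0 := by exact_mod_cast Finset.card_ne_zero.mpr ⟨w, hw⟩
    simp only [hw, if_true]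
    field_simp
  · simp [hw]

lemma sum_stepReal {W : Type u} [Fintype W] (β : Finset W → ℝ) (h : β ∅ = 0) :
    ∑ w, stepReal W β w = ∑ σ, β σ := by
  unfold stepReal
  rw [Finset.sum_comm]
  refine Finset.sum_congr rfl fun σ _ => ?_
  rcases σ.eq_empty_or_nonempty with rfl | hσ
  · simp [h]
  · rw [← Finset.mul_sum, ← Finset.sum_filter]
    have : (σ.card : ℝ) ≠ 0 := by exact_mod_cast Finset.card_ne_zero.mpr hσ
    simp [this]

lemma secStep_mem {W : Type u} [Fintype W] {K : ASC W} {α : W → ℝ} (h : α ∈ K.realization) :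
    secStep α ∈ (sdC K).realization := by
  have hs := stepReal_secStep h.1 (real_le_one h)
  have hsum : ∑ σ, secStep α σ = 1 := by
    rw [← sum_stepReal (secStep α) (by simp [secStep]), hs, h.2.1]
  refine ⟨fun σ => mul_nonneg (Nat.cast_nonneg _) (le_max_left _ _), hsum,
    Finset.univ.filter (fun σ => secStep α σ ≠ 0), ⟨?_, ?_, ?_⟩, fun σ hσ => by simpa using hσ⟩
  · by_contra hne
    rw [Finset.not_nonempty_iff_eq_empty, Finset.filter_eq_empty_iff] at hne
    have : ∑ σ, secStep α σ = 0 := Finset.sum_eq_zero fun v hv => by simpa using hne hv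
    rw [hsum] at this; norm_num at this
  · intro σ hσ
    obtain ⟨hne, t, ht0, -, ht⟩ := gap_pos (by simpa using hσ)
    refine K.down_closed (real_supp_face h) (fun v hv => ?_) hne
    have := (ht v).1 hv
    simp only [Finset.mem_filter, Finset.mem_univ, true_and]
    linarith
  · intro σ hσ τ hτ _
    obtain ⟨-, t, -, -, ht⟩ := gap_pos (α := α) (σ := σ) (by simpa using hσ)
    obtain ⟨-, t', -, -, ht'⟩ := gap_pos (α := α) (σ := τ) (by simpa using hτ)
    rcases le_total t t' with hh | hh
    · right; intro v hv; exact (ht v).2 (hh.trans ((ht' v).1 hv))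
    · left; intro v hv; exact (ht' v).2 (hh.trans ((ht v).1 hv))

lemma secStep_equiv {W : Type u} [Fintype W] {f : W → W} (hf : Function.Bijective f)
    {α α' : W → ℝ} (h : ∀ v, α' (f v) = α v) (σ : Finset W) :
    secStep α' (σ.image f) = secStep α σ := by
  have hc : (σ.image f)ᶜ = (σᶜ).image f := by
    ext v
    obtain ⟨w, rfl⟩ := hf.2 v
    simp [hf.1.eq_iff]
  have e : α' ∘ f = α := funext h
  unfold secStep loS hiS
  rw [hc, Finset.card_image_of_injective _ hf.1, Finset.fold_image (fun _ _ _ _ h => hf.1 h),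
    Finset.fold_image (fun _ _ _ _ h => hf.1 h), e]

lemma image_bij {W : Type u} [Fintype W] {f : W → W} (hf : Function.Bijective f) :
    Function.Bijective (fun σ : Finset W => σ.image f) :=
  Finite.injective_iff_bijective.mp (Finset.image_injective hf.1)

lemma stepReal_equiv {W : Type u} [Fintype W] {f : W → W} (hf : Function.Bijective f)
    {β β' : Finset W → ℝ} (h : ∀ σ, β' (σ.image f) = β σ) (w : W) :
    stepReal W β' (f w) = stepReal W β w := by
  unfold stepReal
  refine ((Equiv.ofBijective _ (image_bij hf)).sum_comp _).symm.trans ?_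
  refine Finset.sum_congr rfl fun σ _ => ?_
  simp only [Equiv.ofBijective_apply]
  rw [h, Finset.card_image_of_injective _ hf.1]
  simp [hf.1.eq_iff]

lemma stepReal_mem {W : Type u} [Fintype W] {K : ASC W} {β : Finset W → ℝ}
    (h : β ∈ (sdC K).realization) : stepReal W β ∈ K.realization := by
  obtain ⟨h0, h1, c, ⟨hcne, hcf, hcc⟩, hs⟩ := h
  refine ⟨fun w => Finset.sum_nonneg fun σ _ => mul_nonneg (h0 σ) (by split_ifs <;> positivity),
    ?_, ?_⟩
  · rw [sum_stepReal, h1]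
    by_contra h
    have := K.nonempty_of_mem (hcf _ (hs _ h))
    simp at this
  · obtain ⟨M, hM, hmax⟩ := c.exists_max_image Finset.card hcne
    refine ⟨M, hcf M hM, fun w hw => ?_⟩
    obtain ⟨σ, -, hσ⟩ := Finset.exists_ne_zero_of_sum_ne_zero hw
    have hβ : β σ ≠ 0 := left_ne_zero_of_mul hσ
    have hwσ : w ∈ σ := by
      by_contra hh; simp [hh] at hσ
    have hσc := hs σ hβ
    by_cases hne : σ = M
    · exact hne ▸ hwσ
    rcases hcc hσc hM hne with hh | hh
    · exact hh hwσ
    · exact absurd (Finset.eq_of_subset_of_card_le hh (hmax σ hσc)).symm hne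

/-! ### The continuous section of `|K^n| → |K|^n` -/

def cumLe {V : Type u} [Fintype V] [PartialOrder V] (x : V → ℝ) (v : V) : ℝ :=
  ∑ u ∈ Finset.univ.filter (fun u => u ≤ v), x u
def cumLt {V : Type u} [Fintype V] [PartialOrder V] (x : V → ℝ) (v : V) : ℝ :=
  ∑ u ∈ Finset.univ.filter (fun u => u < v), x u

lemma cumLe_eq {V : Type u} [Fintype V] [PartialOrder V] (x : V → ℝ) (v : V) :
    cumLe x v = cumLt x v + x v := by
  unfold cumLe cumLt
  have : Finset.univ.filter (fun u => u ≤ v) = insert v (Finset.univ.filter (fun u => u < v)) := by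
    ext u
    simp only [Finset.mem_filter, Finset.mem_univ, true_and, Finset.mem_insert]
    rw [le_iff_lt_or_eq, or_comm]
  rw [this, Finset.sum_insert (by simp), add_comm]

lemma cumLe_le_cumLt {V : Type u} [Fintype V] [PartialOrder V] {x : V → ℝ} (h0 : ∀ v, 0 ≤ x v)
    {v w : V} (h : v < w) : cumLe x v ≤ cumLt x w := by
  refine Finset.sum_le_sum_of_subset_of_nonneg (fun u hu => ?_) (fun u _ _ => h0 u)
  simp only [Finset.mem_filter, Finset.mem_univ, true_and] at hu ⊢
  exact hu.trans_lt h

lemma cumLt_nonneg {V : Type u} [Fintype V] [PartialOrder V] {x : V → ℝ} (h0 : ∀ v, 0 ≤ x v)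
    (v : V) : 0 ≤ cumLt x v := Finset.sum_nonneg fun u _ => h0 u

lemma cumLe_le_one {V : Type u} [Fintype V] [PartialOrder V] {K : ASC V} {x : V → ℝ}
    (h : x ∈ K.realization) (v : V) : cumLe x v ≤ 1 := by
  rw [← h.2.1]
  exact Finset.sum_le_sum_of_subset_of_nonneg (Finset.subset_univ _) (fun u _ _ => h.1 u)

/-- `v` is the `t`-quantile of `x`. -/
def IsQ {V : Type u} [Fintype V] [PartialOrder V] (x : V → ℝ) (t : ℝ) (v : V) : Prop :=
  cumLt x v < t ∧ t ≤ cumLe x v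

lemma isQ_supp {V : Type u} [Fintype V] [PartialOrder V] {x : V → ℝ} {t : ℝ} {v : V}
    (h : IsQ x t v) : x v ≠ 0 := by
  intro h0
  have := h.1.trans_le h.2
  rw [cumLe_eq, h0] at this
  linarith

lemma supp_total {V : Type u} [Fintype V] [PartialOrder V] {K : ASC V}
    (hord : ∀ σ ∈ K.faces, IsChain (· ≤ ·) (σ : Set V)) {x : V → ℝ} (hx : x ∈ K.realization)
    {v w : V} (hv : x v ≠ 0) (hw : x w ≠ 0) : v ≤ w ∨ w ≤ v := by
  have hc := hord _ (real_supp_face hx)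
  exact hc.total (by simpa using hv) (by simpa using hw)

lemma isQ_mono {V : Type u} [Fintype V] [PartialOrder V] {K : ASC V}
    (hord : ∀ σ ∈ K.faces, IsChain (· ≤ ·) (σ : Set V)) {x : V → ℝ} (hx : x ∈ K.realization)
    {t t' : ℝ} {v v' : V} (h : IsQ x t v) (h' : IsQ x t' v') (htt : t ≤ t') : v ≤ v' := by
  rcases supp_total hord hx (isQ_supp h) (isQ_supp h') with hh | hh
  · exact hh
  · rcases hh.eq_or_lt with rfl | hlt
    · exact le_rfl
    · have := cumLe_le_cumLt hx.1 hlt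
      have h1 := h.1
      have h2 := h'.2
      linarith

lemma isQ_exists {V : Type u} [Fintype V] [PartialOrder V] {K : ASC V}
    (hord : ∀ σ ∈ K.faces, IsChain (· ≤ ·) (σ : Set V)) {x : V → ℝ} (hx : x ∈ K.realization)
    {t : ℝ} (h0 : 0 < t) (h1 : t ≤ 1) : ∃ v, IsQ x t v := by
  set S := Finset.univ.filter (fun v => x v ≠ 0 ∧ t ≤ cumLe x v) with hS
  have hne : S.Nonempty := by
    obtain ⟨m, hm⟩ := (Finset.univ.filter (fun v => x v ≠ 0)).exists_maximal
      (K.nonempty_of_mem (real_supp_face hx))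
    have hm0 : x m ≠ 0 := by simpa using hm.1
    refine ⟨m, ?_⟩
    simp only [hS, Finset.mem_filter, Finset.mem_univ, true_and]
    refine ⟨hm0, ?_⟩
    have : cumLe x m = ∑ v, x v := by
      refine Finset.sum_subset (Finset.subset_univ _) fun u _ hu => ?_
      by_contra hu0
      simp only [Finset.mem_filter, Finset.mem_univ, true_and] at hu
      rcases supp_total hord hx hu0 hm0 with hh | hh
      · exact hu hh
      · exact hu (hm.2 (by simpa using hu0) hh)
    rw [this, hx.2.1]; exact h1
  obtain ⟨v, hv⟩ := S.exists_minimal hne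
  have hvS := hv.1
  simp only [hS, Finset.mem_filter, Finset.mem_univ, true_and] at hvS
  refine ⟨v, ?_, hvS.2⟩
  by_contra hlt
  rw [not_lt] at hlt
  set S' := Finset.univ.filter (fun u => u < v ∧ x u ≠ 0) with hS'
  have hne' : S'.Nonempty := by
    by_contra hh
    rw [Finset.not_nonempty_iff_eq_empty, Finset.filter_eq_empty_iff] at hh
    have : cumLt x v = 0 := by
      refine Finset.sum_eq_zero fun u hu => ?_
      simp only [Finset.mem_filter, Finset.mem_univ, true_and] at hu
      by_contra h
      exact hh (Finset.mem_univ u) ⟨hu, h⟩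
    linarith
  obtain ⟨m, hm⟩ := S'.exists_maximal hne'
  have hmS := hm.1
  simp only [hS', Finset.mem_filter, Finset.mem_univ, true_and] at hmS
  have hle : cumLt x v ≤ cumLe x m := by
    unfold cumLt cumLe
    rw [← Finset.sum_filter_ne_zero]
    refine Finset.sum_le_sum_of_subset_of_nonneg (fun u hu => ?_) (fun u _ _ => hx.1 u)
    simp only [Finset.mem_filter, Finset.mem_univ, true_and] at hu ⊢
    rcases supp_total hord hx hu.2 hmS.2 with hh | hh
    · exact hh
    · exact hm.2 (by simp [hS', hu.1, hu.2]) hh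
  have : v ≤ m := hv.2 (by
    simp only [hS, Finset.mem_filter, Finset.mem_univ, true_and]
    exact ⟨hmS.2, hlt.trans hle⟩) hmS.1.le
  exact absurd this (not_le_of_gt hmS.1)

def loP {V : Type u} [Fintype V] [PartialOrder V] {n : ℕ} (x : Fin n → V → ℝ) (w : Fin n → V) :
    ℝ := (Finset.univ : Finset (Fin n)).fold max 0 (fun j => cumLt (x j) (w j))
def hiP {V : Type u} [Fintype V] [PartialOrder V] {n : ℕ} (x : Fin n → V → ℝ) (w : Fin n → V) :
    ℝ := (Finset.univ : Finset (Fin n)).fold min 1 (fun j => cumLe (x j) (w j))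

def secP {V : Type u} [Fintype V] [PartialOrder V] {n : ℕ} (x : Fin n → V → ℝ)
    (w : Fin n → V) : ℝ := max 0 (hiP x w - loP x w)

lemma continuous_secP {V : Type u} [Fintype V] [PartialOrder V] {n : ℕ} :
    Continuous (secP : (Fin n → V → ℝ) → ((Fin n → V) → ℝ)) := by
  refine continuous_pi fun w => ?_
  unfold secP hiP loP
  refine continuous_const.max (Continuous.sub ?_ ?_)
  · refine continuous_foldMin _ (fun j (x : Fin n → V → ℝ) => cumLe (x j) (w j)) (fun j => ?_) _
    unfold cumLe; fun_prop
  · refine continuous_foldMax _ (fun j (x : Fin n → V → ℝ) => cumLt (x j) (w j)) (fun j => ?_) _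
    unfold cumLt; fun_prop

lemma mem_gapP_iff {V : Type u} [Fintype V] [PartialOrder V] {n : ℕ} (x : Fin n → V → ℝ)
    (w : Fin n → V) (t : ℝ) :
    t ∈ Set.Ioc (loP x w) (hiP x w) ↔ 0 < t ∧ t ≤ 1 ∧ ∀ j, IsQ (x j) t (w j) := by
  unfold loP hiP
  rw [Set.mem_Ioc, Finset.fold_max_lt, Finset.le_fold_min]
  constructor
  · rintro ⟨⟨h1, h2⟩, h3, h4⟩
    exact ⟨h1, h3, fun j => ⟨h2 j (Finset.mem_univ _), h4 j (Finset.mem_univ _)⟩⟩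
  · rintro ⟨h1, h2, h3⟩
    exact ⟨⟨h1, fun j _ => (h3 j).1⟩, h2, fun j _ => (h3 j).2⟩

lemma gapP_pos {V : Type u} [Fintype V] [PartialOrder V] {n : ℕ} {x : Fin n → V → ℝ}
    {w : Fin n → V} (h : secP x w ≠ 0) : ∃ t, 0 < t ∧ t ≤ 1 ∧ ∀ j, IsQ (x j) t (w j) := by
  have h2 : 0 < hiP x w - loP x w := by
    by_contra hh
    exact h (max_eq_left (not_lt.mp hh))
  exact ⟨hiP x w, (mem_gapP_iff x w _).1 ⟨by linarith, le_rfl⟩⟩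

lemma realizeMap_secP {V : Type u} [Fintype V] [PartialOrder V] {K : ASC V}
    (hord : ∀ σ ∈ K.faces, IsChain (· ≤ ·) (σ : Set V)) {n : ℕ} {x : Fin n → V → ℝ}
    (hx : ∀ j, x j ∈ K.realization) (j : Fin n) :
    realizeMap (fun w : Fin n → V => w j) (secP x) = x j := by
  funext v
  unfold realizeMap secP
  have hcl : cumLt (x j) v ≤ cumLe (x j) v := by
    rw [cumLe_eq]; linarith [(hx j).1 v]
  rw [sumLen_eq _ (loP x) (hiP x) (cumLt (x j) v) (cumLe (x j) v) hcl]
  · rw [cumLe_eq]; ring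
  · intro t
    constructor
    · rintro ⟨ht, ht'⟩
      have ht0 : 0 < t := (cumLt_nonneg (hx j).1 v).trans_lt ht
      have ht1 : t ≤ 1 := ht'.trans (cumLe_le_one (hx j) v)
      choose w hw using fun i => isQ_exists hord (hx i) ht0 ht1
      refine ⟨w, ?_, (mem_gapP_iff x w t).2 ⟨ht0, ht1, hw⟩⟩
      simp only [Finset.mem_filter, Finset.mem_univ, true_and]
      exact le_antisymm (isQ_mono hord (hx j) (hw j) ⟨ht, ht'⟩ le_rfl)
        (isQ_mono hord (hx j) ⟨ht, ht'⟩ (hw j) le_rfl)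
    · rintro ⟨w, hw, ht⟩
      simp only [Finset.mem_filter, Finset.mem_univ, true_and] at hw
      rw [mem_gapP_iff] at ht
      rw [← hw]
      exact ht.2.2 j
  · intro w _ w' _ t h h'
    rw [mem_gapP_iff] at h h'
    funext i
    exact le_antisymm (isQ_mono hord (hx i) (h.2.2 i) (h'.2.2 i) le_rfl)
        (isQ_mono hord (hx i) (h'.2.2 i) (h.2.2 i) le_rfl)

lemma sum_realizeMap {V : Type u} {W : Type v} [Fintype V] [Fintype W] (f : V → W) (α : V → ℝ) :
    ∑ w, realizeMap f α w = ∑ v, α v := by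
  unfold realizeMap
  exact Finset.sum_fiberwise _ _ _

lemma secP_mem {V : Type u} [Fintype V] [PartialOrder V] {K : ASC V}
    (hord : ∀ σ ∈ K.faces, IsChain (· ≤ ·) (σ : Set V)) {n : ℕ} (hn : 0 < n) {x : Fin n → V → ℝ}
    (hx : ∀ j, x j ∈ K.realization) : secP x ∈ (powC K n).realization := by
  have hsum : ∑ w, secP x w = 1 := by
    rw [← sum_realizeMap (fun w : Fin n → V => w ⟨0, hn⟩) (secP x), realizeMap_secP hord hx]
    exact (hx _).2.1
  have hne : (Finset.univ.filter (fun σ => secP x σ ≠ 0)).Nonempty := by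
    by_contra hne
    rw [Finset.not_nonempty_iff_eq_empty, Finset.filter_eq_empty_iff] at hne
    have : ∑ σ, secP x σ = 0 := Finset.sum_eq_zero fun v hv => by simpa using hne hv
    rw [hsum] at this; norm_num at this
  refine ⟨fun σ => le_max_left _ _, hsum,
    Finset.univ.filter (fun σ => secP x σ ≠ 0), ⟨hne, ?_, ?_⟩, fun σ hσ => by simpa using hσ⟩
  · intro w hw w' hw' _
    obtain ⟨t, -, -, ht⟩ := gapP_pos (x := x) (w := w) (by simpa using hw)
    obtain ⟨t', -, -, ht'⟩ := gapP_pos (x := x) (w := w') (by simpa using hw')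
    rcases le_total t t' with hh | hh
    · left; intro i; exact isQ_mono hord (hx i) (ht i) (ht' i) hh
    · right; intro i; exact isQ_mono hord (hx i) (ht' i) (ht i) hh
  · intro j
    refine K.down_closed (real_supp_face (hx j)) (fun v hv => ?_) (hne.image _)
    rw [Finset.mem_image] at hv
    obtain ⟨w, hw, rfl⟩ := hv
    obtain ⟨t, -, -, ht⟩ := gapP_pos (x := x) (w := w) (by simpa using hw)
    simpa using isQ_supp (ht j)

lemma secP_equiv {V : Type u} [Fintype V] [PartialOrder V] {n : ℕ} (g : Equiv.Perm (Fin n))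
    (x : Fin n → V → ℝ) (w : Fin n → V) :
    secP (fun j => x (g j)) (pAct g w) = secP x w := by
  have hu : (Finset.univ : Finset (Fin n)) = Finset.univ.image g := by simp
  unfold secP hiP loP
  conv_rhs => rw [hu]
  rw [Finset.fold_image (fun _ _ _ _ h => g.injective h),
    Finset.fold_image (fun _ _ _ _ h => g.injective h)]
  rfl

lemma realizeMap_mem {V : Type u} {W : Type v} [Fintype V] [Fintype W] {L : ASC W}
    {f : V → W} {α : V → ℝ} (h0 : ∀ v, 0 ≤ α v) (h1 : ∑ v, α v = 1) {τ : Finset W}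
    (hτ : τ ∈ L.faces) (hs : ∀ v, α v ≠ 0 → f v ∈ τ) : realizeMap f α ∈ L.realization := by
  refine ⟨fun w => Finset.sum_nonneg fun v _ => h0 v, by rw [sum_realizeMap, h1], τ, hτ,
    fun w hw => ?_⟩
  obtain ⟨v, hv, hv'⟩ := Finset.exists_ne_zero_of_sum_ne_zero hw
  simp only [Finset.mem_filter, Finset.mem_univ, true_and] at hv
  exact hv ▸ hs v hv'

lemma proj_mem {V : Type u} [Fintype V] [PartialOrder V] {K : ASC V} {n : ℕ}
    {β : (Fin n → V) → ℝ} (h : β ∈ (powC K n).realization) (j : Fin n) :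
    realizeMap (fun w : Fin n → V => w j) β ∈ K.realization := by
  obtain ⟨h0, h1, σ, hσ, hs⟩ := h
  exact realizeMap_mem h0 h1 (hσ.2.2 j) (fun v hv => Finset.mem_image_of_mem _ (hs v hv))

/-! ### Iterating -/

def secR {V' : Type u} [Fintype V'] (α : V' → ℝ) : (r : ℕ) → (SdT V' r → ℝ)
  | 0 => α
  | r + 1 => (secStep (secR α r) : Finset (SdT V' r) → ℝ)

lemma secR_mem {V' : Type u} [Fintype V'] {K : ASC V'} {α : V' → ℝ} (h : α ∈ K.realization)
    (r : ℕ) : secR α r ∈ (CIter K r).realization := by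
  induction r with
  | zero => exact h
  | succ r ih => exact secStep_mem ih

lemma continuous_secR {V' : Type u} [Fintype V'] (r : ℕ) :
    Continuous (fun α : V' → ℝ => secR α r) := by
  induction r with
  | zero => exact continuous_id
  | succ r ih => exact continuous_secStep.comp ih

lemma iterReal_secR {V' : Type u} [Fintype V'] {K : ASC V'} {α : V' → ℝ} (h : α ∈ K.realization)
    (r : ℕ) : iterReal V' r (secR α r) = α := by
  induction r with
  | zero => rfl
  | succ r ih =>
    have hm := secR_mem h r
    change iterReal V' r (stepReal (SdT V' r) (secStep (secR α r))) = α
    rw [stepReal_secStep hm.1 (real_le_one hm), ih]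

lemma sdMap_bij {V' : Type u} [Fintype V'] {f : V' → V'} (hf : Function.Bijective f) (r : ℕ) :
    Function.Bijective (SdMap V' f r) := by
  induction r with
  | zero => exact hf
  | succ r ih => exact image_bij ih

lemma secR_equiv {V' : Type u} [Fintype V'] {f : V' → V'} (hf : Function.Bijective f)
    {α α' : V' → ℝ} (h : ∀ v, α' (f v) = α v) (r : ℕ) (x : SdT V' r) :
    secR α' r (SdMap V' f r x) = secR α r x := by
  induction r with
  | zero => exact h x
  | succ r ih => exact secStep_equiv (sdMap_bij hf r) ih x

lemma iterReal_equiv {V' : Type u} [Fintype V'] {f : V' → V'} (hf : Function.Bijective f)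
    (r : ℕ) {β β' : SdT V' r → ℝ} (h : ∀ x, β' (SdMap V' f r x) = β x) (w : V') :
    iterReal V' r β' (f w) = iterReal V' r β w := by
  induction r with
  | zero => exact h w
  | succ r ih => exact ih (fun x => stepReal_equiv (sdMap_bij hf r) h x)

lemma iterReal_mem {V' : Type u} [Fintype V'] {K : ASC V'} (r : ℕ) {β : SdT V' r → ℝ}
    (h : β ∈ (CIter K r).realization) : iterReal V' r β ∈ K.realization := by
  induction r with
  | zero => exact h
  | succ r ih => exact ih (stepReal_mem h)

lemma pAct_bij {X : Type u} {n : ℕ} (g : Equiv.Perm (Fin n)) :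
    Function.Bijective (pAct g : (Fin n → X) → (Fin n → X)) := by
  constructor
  · intro x y h
    funext j
    have := congrFun h (g.symm j)
    simpa [pAct] using this
  · intro y
    exact ⟨fun j => y (g.symm j), by funext j; simp [pAct]⟩

/-- The approximations `ι^r` satisfy the star condition. -/
lemma compIota_star {V : Type u} [Fintype V] [PartialOrder V] {K : ASC V} {n : ℕ}
    {ιs : (s : ℕ) → Finset (SdT (Fin n → V) s) → SdT (Fin n → V) s}
    (hι : ∀ r, GoodIota K n r ιs) (r : ℕ) {β : SdT (Fin n → V) r → ℝ}
    (hβ : β ∈ (CIter (powC K n) r).realization) (x : SdT (Fin n → V) r) (hx : β x ≠ 0) :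
    iterReal (Fin n → V) r β (compIota ιs r x) ≠ 0 := by
  induction r with
  | zero => exact hx
  | succ r ih =>
    have := (hι (r + 1) r (Nat.lt_succ_self r)).2.1 x β ⟨hβ, hx⟩
    exact ih this.1 _ this.2

lemma compIota_equiv {V : Type u} [Fintype V] [PartialOrder V] {K : ASC V} {n : ℕ}
    {ιs : (s : ℕ) → Finset (SdT (Fin n → V) s) → SdT (Fin n → V) s}
    (hι : ∀ r, GoodIota K n r ιs) (r : ℕ) (g : Equiv.Perm (Fin n)) (x : SdT (Fin n → V) r) :
    compIota ιs r (SdMap (Fin n → V) (pAct g) r x) = pAct g (compIota ιs r x) := by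
  induction r with
  | zero => rfl
  | succ r ih =>
    have := (hι (r + 1) r (Nat.lt_succ_self r)).2.2 g x
    change compIota ιs r (ιs r (SdMap (Fin n → V) (pAct g) (r + 1) x)) = _
    rw [this, ih]; rfl

/-- `sd^r(K^n)` is invariant. -/
lemma powC_inv {V : Type u} [PartialOrder V] {K : ASC V} {n : ℕ} (g : Equiv.Perm (Fin n)) :
    ∀ σ ∈ (powC K n).faces, σ.image (pAct g) ∈ (powC K n).faces := by
  rintro σ ⟨h1, h2, h3⟩
  refine ⟨h1.image _, ?_, fun j => ?_⟩
  · intro a ha b hb _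
    simp only [Finset.coe_image, Set.mem_image, Finset.mem_coe] at ha hb
    obtain ⟨a, ha, rfl⟩ := ha
    obtain ⟨b, hb, rfl⟩ := hb
    rcases h2.total ha hb with h | h
    · left; intro j; exact h (g j)
    · right; intro j; exact h (g j)
  · rw [Finset.image_image]
    exact h3 (g j)

lemma sdC_inv {W : Type u} {K : ASC W} {f : W → W}
    (h : ∀ σ ∈ K.faces, σ.image f ∈ K.faces) (inst : DecidableEq (Finset W))
    (F : Finset W → Finset W) (hF : ∀ σ, F σ = σ.image f) :
    ∀ c ∈ (sdC K).faces, @Finset.image _ _ inst F c ∈ (sdC K).faces := by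
  rintro c ⟨h1, h2, h3⟩
  refine ⟨h1.image _, ?_, ?_⟩
  · intro σ hσ
    rw [Finset.mem_image] at hσ
    obtain ⟨τ, hτ, rfl⟩ := hσ
    rw [hF]
    exact h τ (h2 τ hτ)
  · intro a ha b hb _
    simp only [Finset.coe_image, Set.mem_image, Finset.mem_coe] at ha hb
    obtain ⟨a, ha, rfl⟩ := ha
    obtain ⟨b, hb, rfl⟩ := hb
    rw [hF, hF]
    rcases h3.total ha hb with h | h
    · left; exact Finset.image_subset_image h
    · right; exact Finset.image_subset_image h

lemma cIter_inv {V' : Type u} {K : ASC V'} {f : V' → V'}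
    (h : ∀ σ ∈ K.faces, σ.image f ∈ K.faces) (r : ℕ) :
    ∀ σ ∈ (CIter K r).faces, σ.image (SdMap V' f r) ∈ (CIter K r).faces := by
  induction r with
  | zero => exact h
  | succ r ih => exact sdC_inv ih _ (SdMap V' f (r + 1)) (fun _ => rfl)

/-! ### Piecewise linear paths -/

def clampU (s : ℝ) : ℝ := max 0 (min 1 s)

lemma continuous_clampU : Continuous clampU := by unfold clampU; fun_prop

def plPath {E : Type*} [AddCommGroup E] [Module ℝ E] (P : ℕ → E) (m : ℕ) (a : ℝ) : E :=
  P 0 + ∑ l ∈ Finset.range m, clampU (a - l) • (P (l + 1) - P l)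

lemma plPath_end {E : Type*} [AddCommGroup E] [Module ℝ E] (P : ℕ → E) (m : ℕ) (a : ℝ)
    (ha : (m : ℝ) ≤ a) : plPath P m a = P m := by
  induction m with
  | zero => simp [plPath]
  | succ m ih =>
    push_cast at ha
    have h := ih (by linarith)
    unfold plPath at h ⊢
    rw [Finset.sum_range_succ, ← add_assoc, h]
    have : clampU (a - m) = 1 := by
      unfold clampU
      rw [min_eq_left (by linarith)]; simp
    rw [this, one_smul]; abel

lemma plPath_zero {E : Type*} [AddCommGroup E] [Module ℝ E] (P : ℕ → E) (m : ℕ) :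
    plPath P m 0 = P 0 := by
  unfold plPath
  rw [Finset.sum_eq_zero, add_zero]
  intro l _
  have : clampU ((0 : ℝ) - l) = 0 := by
    unfold clampU
    apply max_eq_left
    exact (min_le_right _ _).trans (by simp)
  rw [this, zero_smul]

lemma clampU_mem (s : ℝ) : 0 ≤ clampU s ∧ clampU s ≤ 1 :=
  ⟨le_max_left _ _, max_le zero_le_one (min_le_left _ _)⟩

lemma plPath_seg {E : Type*} [AddCommGroup E] [Module ℝ E] (P : ℕ → E) (m : ℕ) (hm : 0 < m)
    (a : ℝ) : ∃ l < m, ∃ s : ℝ, 0 ≤ s ∧ s ≤ 1 ∧ plPath P m a = P l + s • (P (l + 1) - P l) := by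
  induction m with
  | zero => omega
  | succ m ih =>
    have hs : plPath P (m + 1) a = plPath P m a + clampU (a - m) • (P (m + 1) - P m) := by
      unfold plPath
      rw [Finset.sum_range_succ, ← add_assoc]
    rcases Nat.eq_zero_or_pos m with rfl | hm'
    · exact ⟨0, by omega, clampU a, (clampU_mem _).1, (clampU_mem _).2, by
        rw [hs]; simp [plPath]⟩
    · by_cases ha : (m : ℝ) ≤ a
      · exact ⟨m, by omega, _, (clampU_mem _).1, (clampU_mem _).2, by
          rw [hs, plPath_end P m a ha]⟩
      · obtain ⟨l, hl, s, h0, h1, h⟩ := ih hm'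
        refine ⟨l, by omega, s, h0, h1, ?_⟩
        have : clampU (a - m) = 0 := by
          unfold clampU
          apply max_eq_left
          exact (min_le_right _ _).trans (by linarith)
        rw [hs, this, zero_smul, add_zero, h]

lemma segment_mem {V : Type u} [Fintype V] {K : ASC V} {α β : V → ℝ} (hα : α ∈ K.realization)
    (hβ : β ∈ K.realization) {τ : Finset V} (hτ : τ ∈ K.faces) (h1 : ∀ v, α v ≠ 0 → v ∈ τ)
    (h2 : ∀ v, β v ≠ 0 → v ∈ τ) {s : ℝ} (hs0 : 0 ≤ s) (hs1 : s ≤ 1) :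
    α + s • (β - α) ∈ K.realization := by
  refine ⟨fun v => ?_, ?_, τ, hτ, fun v hv => ?_⟩
  · have := hα.1 v
    have := hβ.1 v
    simp only [Pi.add_apply, Pi.smul_apply, Pi.sub_apply, smul_eq_mul]
    nlinarith
  · simp only [Pi.add_apply, Pi.smul_apply, Pi.sub_apply, smul_eq_mul]
    rw [Finset.sum_add_distrib, ← Finset.mul_sum, Finset.sum_sub_distrib, hα.2.1, hβ.2.1]
    ring
  · by_contra hh
    have a0 : α v = 0 := by by_contra h; exact hh (h1 v h)
    have b0 : β v = 0 := by by_contra h; exact hh (h2 v h)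
    exact hv (by simp [a0, b0])

instance realization_compact {V : Type u} [Fintype V] (K : ASC V) :
    CompactSpace ↥(K.realization) := by
  rw [← isCompact_iff_compactSpace]
  have hE : K.realization = ⋃ σ ∈ K.faces,
      {α : V → ℝ | (∀ v, 0 ≤ α v) ∧ (∑ v, α v) = 1 ∧ ∀ v, v ∉ σ → α v = 0} := by
    ext α
    simp only [ASC.realization, Set.mem_ofPred_eq, Set.mem_iUnion, exists_prop]
    constructor
    · rintro ⟨h0, h1, σ, hσ, h⟩
      exact ⟨σ, hσ, h0, h1, fun v hv => by by_contra hh; exact hv (h v hh)⟩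
    · rintro ⟨σ, hσ, h0, h1, h⟩
      exact ⟨h0, h1, σ, hσ, fun v hv => by by_contra hh; exact hv (h v hh)⟩
  have hcl : IsClosed K.realization := by
    rw [hE]
    refine Set.Finite.isClosed_biUnion (Set.toFinite _) fun σ _ => ?_
    refine IsClosed.inter (s₁ := {α : V → ℝ | ∀ v, 0 ≤ α v}) ?_ (IsClosed.inter
      (s₁ := {α : V → ℝ | (∑ v, α v) = 1}) (s₂ := {α : V → ℝ | ∀ v, v ∉ σ → α v = 0}) ?_ ?_)
    · simp only [Set.ofPred_forall]
      exact isClosed_iInter fun v => isClosed_le continuous_const (continuous_apply v)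
    · exact isClosed_eq (by fun_prop) continuous_const
    · simp only [Set.ofPred_forall]
      exact isClosed_iInter fun v => isClosed_iInter fun _ =>
        isClosed_eq (continuous_apply v) continuous_const
  refine Metric.isCompact_of_isClosed_isBounded hcl ?_
  refine (Metric.isBounded_closedBall (x := (0 : V → ℝ)) (r := 1)).subset fun α hα => ?_
  rw [mem_closedBall_zero_iff, pi_norm_le_iff_of_nonneg zero_le_one]
  intro v
  rw [Real.norm_eq_abs, abs_of_nonneg (hα.1 v)]
  exact real_le_one hα v

/-- Building a motion planner from piecewise linear data. -/
lemma exists_planner {V : Type u} [Fintype V] {K : ASC V} {n : ℕ}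
    (U : Set (Fin n → ↥(K.realization))) (hU : IsOpen U)
    (P : Fin n → ℕ → (Fin n → ↥(K.realization)) → (V → ℝ)) (m : ℕ) (hm : 0 < m)
    (hc : ∀ j l, ContinuousOn (P j l) U)
    (hseg : ∀ j, ∀ l < m, ∀ x ∈ U, ∀ s : ℝ, 0 ≤ s → s ≤ 1 →
      P j l x + s • (P j (l + 1) x - P j l x) ∈ K.realization)
    (h0 : ∀ j j', P j 0 = P j' 0)
    (h1 : ∀ j x, P j m x = (x j).1)
    (hg : ∀ (g : Equiv.Perm (Fin n)), ∀ x ∈ U, ∀ j, ∀ l ≤ m,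
      P j l (fun j => x (g j)) = P (g j) l x) :
    ∃ s : C(↥U, C(WedgeI n, ↥(K.realization))),
        (∀ (x : ↥U) (j : Fin n), (s x) (arm n j 1) = x.1 j) ∧
        ∀ (g : Equiv.Perm (Fin n)) (x : Fin n → ↥(K.realization)) (hx : x ∈ U)
          (hgx : (fun j => x (g j)) ∈ U) (t : unitInterval) (j : Fin n),
          (s ⟨fun j => x (g j), hgx⟩) (arm n j t) = (s ⟨x, hx⟩) (arm n (g j) t) := by
  let γ : Fin n → unitInterval × ↥U → V → ℝ :=
    fun j p => plPath (fun l => P j l p.2.1) m ((p.1 : ℝ) * m)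
  have hγm : ∀ j p, γ j p ∈ K.realization := by
    intro j p
    obtain ⟨l, hl, s, hs0, hs1, h⟩ := plPath_seg (fun l => P j l p.2.1) m hm ((p.1 : ℝ) * m)
    change plPath (fun l => P j l p.2.1) m ((p.1 : ℝ) * m) ∈ _
    rw [h]
    exact hseg j l hl p.2.1 p.2.2 s hs0 hs1
  have hPc : ∀ j l, Continuous fun p : unitInterval × ↥U => P j l p.2.1 := by
    intro j l
    have := (continuousOn_iff_continuous_domRestrict.mp (hc j l))
    exact this.comp continuous_snd
  have hγc : ∀ j, Continuous (γ j) := by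
    intro j
    change Continuous fun p : unitInterval × ↥U =>
      plPath (fun l => P j l p.2.1) m ((p.1 : ℝ) * m)
    unfold plPath
    refine (hPc j 0).add (continuous_finsetSum _ fun l _ => ?_)
    refine Continuous.smul (continuous_clampU.comp ?_) ((hPc j (l + 1)).sub (hPc j l))
    fun_prop
  let Γ : Fin n → unitInterval × ↥U → ↥(K.realization) := fun j p => ⟨γ j p, hγm j p⟩
  have hΓc : ∀ j, Continuous (Γ j) := fun j => (hγc j).subtype_mk _
  have hγ0 : ∀ j (x : ↥U), γ j (0, x) = P j 0 x.1 := by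
    intro j x
    change plPath (fun l => P j l x.1) m (((0 : unitInterval) : ℝ) * m) = _
    rw [Set.Icc.coe_zero, zero_mul, plPath_zero]
  let G : ↥U × WedgeI n → ↥(K.realization) := fun q =>
    Quotient.lift (s := wedgeSetoid n) (fun p : Fin n × unitInterval => Γ p.1 (p.2, q.1)) (by
      rintro ⟨j, t⟩ ⟨j', t'⟩ (h | ⟨h, h'⟩)
      · rw [h]
      · apply Subtype.ext
        dsimp only at h h'
        change γ j (t, q.1) = γ j' (t', q.1)
        rw [h, h', hγ0, hγ0, h0 j j']) q.2
  have hq : Topology.IsQuotientMap (Quotient.mk (wedgeSetoid n)) := isQuotientMap_quotient_mk'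
  have : LocallyCompactSpace ↥U := hU.locallyCompactSpace
  have hG : Continuous G := by
    refine Topology.IsQuotientMap.continuous_lift_prod_right (X := WedgeI n) hq ?_
    have h1 : Continuous (Function.uncurry Γ) := continuous_prod_of_discrete_left.mpr hΓc
    exact h1.comp (f := fun p : ↥U × (Fin n × unitInterval) => (p.2.1, (p.2.2, p.1)))
      (by fun_prop)
  refine ⟨(ContinuousMap.mk G hG).curry, ?_, ?_⟩
  · intro x j
    apply Subtype.ext
    change plPath (fun l => P j l x.1) m (((1 : unitInterval) : ℝ) * m) = _
    rw [plPath_end _ _ _ (by simp), h1]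
  · intro g x hx hgx t j
    apply Subtype.ext
    change plPath (fun l => P j l (fun j => x (g j))) m ((t : ℝ) * m) =
      plPath (fun l => P (g j) l x) m ((t : ℝ) * m)
    unfold plPath
    dsimp only
    rw [hg g x hx j 0 (Nat.zero_le _)]
    congr 1
    refine Finset.sum_congr rfl fun l hl => ?_
    rw [Finset.mem_range] at hl
    rw [hg g x hx j l hl.le, hg g x hx j (l + 1) hl]

/-! ### Trimming barycentric coordinates -/

def bigS {W : Type u} [Fintype W] (α : W → ℝ) : Finset W :=
  Finset.univ.filter (fun v => ((Fintype.card W : ℝ) + 1)⁻¹ ≤ α v)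

def trimN {W : Type u} [Fintype W] (α : W → ℝ) (v : W) : ℝ :=
  max 0 (α v - ((Fintype.card W : ℝ) + 1)⁻¹)

def trim {W : Type u} [Fintype W] (α : W → ℝ) (v : W) : ℝ :=
  trimN α v / ∑ u, trimN α u

lemma exists_big {W : Type u} [Fintype W] {α : W → ℝ} (h : ∑ v, α v = 1) :
    ∃ v, ((Fintype.card W : ℝ) + 1)⁻¹ < α v := by
  by_contra! hh
  have : ∑ v, α v ≤ ∑ _v : W, ((Fintype.card W : ℝ) + 1)⁻¹ := Finset.sum_le_sum fun v _ => hh v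
  rw [h, Finset.sum_const, Finset.card_univ, nsmul_eq_mul, ← div_eq_mul_inv,
    le_div_iff₀ (by positivity)] at this
  linarith

lemma trimN_sum_pos {W : Type u} [Fintype W] {α : W → ℝ} (h : ∑ v, α v = 1) :
    0 < ∑ u, trimN α u := by
  obtain ⟨v, hv⟩ := exists_big h
  refine Finset.sum_pos' (fun _ _ => le_max_left _ _) ⟨v, Finset.mem_univ v, ?_⟩
  exact lt_max_of_lt_right (by linarith)

lemma trim_nonneg {W : Type u} [Fintype W] (α : W → ℝ) (v : W) : 0 ≤ trim α v :=
  div_nonneg (le_max_left _ _) (Finset.sum_nonneg fun u _ => le_max_left _ _)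

lemma trim_sum {W : Type u} [Fintype W] {α : W → ℝ} (h : ∑ v, α v = 1) : ∑ v, trim α v = 1 := by
  unfold trim
  rw [← Finset.sum_div, div_self (trimN_sum_pos h).ne']

lemma trim_supp {W : Type u} [Fintype W] {α : W → ℝ} {v : W} (h : trim α v ≠ 0) : v ∈ bigS α := by
  unfold bigS
  simp only [Finset.mem_filter, Finset.mem_univ, true_and]
  by_contra hh
  apply h
  unfold trim trimN
  rw [max_eq_left (by linarith), zero_div]

lemma bigS_supp {W : Type u} [Fintype W] {α : W → ℝ} {v : W} (h : v ∈ bigS α) : α v ≠ 0 := by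
  unfold bigS at h
  simp only [Finset.mem_filter, Finset.mem_univ, true_and] at h
  have : 0 < ((Fintype.card W : ℝ) + 1)⁻¹ := by positivity
  linarith

lemma bigS_nonempty {W : Type u} [Fintype W] {α : W → ℝ} (h : ∑ v, α v = 1) :
    (bigS α).Nonempty := by
  obtain ⟨v, hv⟩ := exists_big h
  exact ⟨v, by simpa [bigS] using hv.le⟩

lemma bigS_face {W : Type u} [Fintype W] {K : ASC W} {α : W → ℝ} (h : α ∈ K.realization) :
    bigS α ∈ K.faces :=
  K.down_closed (real_supp_face h) (fun v hv => by simpa using bigS_supp hv) (bigS_nonempty h.2.1)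

lemma continuous_trim {X W : Type*} [TopologicalSpace X] [Fintype W] (f : X → W → ℝ)
    (hf : Continuous f) (h : ∀ x, ∑ v, f x v = 1) : Continuous fun x => trim (f x) := by
  refine continuous_pi fun v => ?_
  unfold trim
  have hN : ∀ u, Continuous fun x => trimN (f x) u := by
    intro u
    unfold trimN
    have := (continuous_apply u).comp hf
    exact continuous_const.max (this.sub continuous_const)
  exact (hN v).div (continuous_finsetSum _ fun u _ => hN u) fun x => (trimN_sum_pos (h x)).ne'

lemma bigS_open {X W : Type*} [TopologicalSpace X] [Fintype W] (f : X → W → ℝ)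
    (hf : Continuous f) (h : ∀ x, ∑ v, f x v = 1) (L : ASC W) :
    IsOpen {x | bigS (f x) ∈ L.faces} := by
  rw [isOpen_iff_mem_nhds]
  intro x hx
  have : ∀ᶠ y in nhds x, ∀ v, v ∉ bigS (f x) → f y v < ((Fintype.card W : ℝ) + 1)⁻¹ := by
    rw [Filter.eventually_all]
    intro v
    by_cases hv : v ∈ bigS (f x)
    · exact Filter.Eventually.of_forall fun y hh => absurd hv hh
    · have hlt : f x v < ((Fintype.card W : ℝ) + 1)⁻¹ := by simpa [bigS] using hv
      filter_upwards [((continuous_apply v).comp hf).continuousAt.eventually_lt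
        continuousAt_const hlt] with y hy _ using hy
  filter_upwards [this] with y hy
  refine L.down_closed hx (fun v hv => ?_) (bigS_nonempty (h y))
  by_contra hh
  have h1 := hy v hh
  simp only [bigS, Finset.mem_filter, Finset.mem_univ, true_and] at hv
  linarith

lemma bigS_equiv {W : Type u} [Fintype W] {f : W → W} (hf : Function.Bijective f)
    {α α' : W → ℝ} (h : ∀ v, α' (f v) = α v) : bigS α' = (bigS α).image f := by
  ext v
  obtain ⟨w, rfl⟩ := hf.2 v
  simp [bigS, h, hf.1.eq_iff]

lemma trim_equiv {W : Type u} [Fintype W] {f : W → W} (hf : Function.Bijective f)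
    {α α' : W → ℝ} (h : ∀ v, α' (f v) = α v) (v : W) : trim α' (f v) = trim α v := by
  have hN : ∀ v, trimN α' (f v) = trimN α v := fun v => by unfold trimN; rw [h]
  unfold trim
  rw [hN, ← (Equiv.ofBijective f hf).sum_comp]
  simp only [Equiv.ofBijective_apply, hN]

lemma realizeMap_equiv {W : Type u} {V : Type v} [Fintype W] {f : W → W}
    (hf : Function.Bijective f) {α α' : W → ℝ} (h : ∀ v, α' (f v) = α v) {p q : W → V}
    (hpq : ∀ v, α v ≠ 0 → p (f v) = q v) : realizeMap p α' = realizeMap q α := by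
  funext w
  unfold realizeMap
  rw [Finset.sum_filter, Finset.sum_filter, ← (Equiv.ofBijective f hf).sum_comp]
  refine Finset.sum_congr rfl fun v _ => ?_
  simp only [Equiv.ofBijective_apply, h]
  by_cases h0 : α v = 0
  · simp [h0]
  · rw [hpq v h0]

lemma continuous_realizeMap {W : Type u} {V : Type v} [Fintype W] (p : W → V) :
    Continuous (realizeMap p : (W → ℝ) → (V → ℝ)) := by
  refine continuous_pi fun v => ?_
  unfold realizeMap
  fun_prop

theorem TC_le_of_SCle {V : Type u} [Fintype V] [PartialOrder V] (K : ASC V)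
    (hord : ∀ σ ∈ K.faces, IsChain (· ≤ ·) (σ : Set V))
    (n : ℕ) (hn : 2 ≤ n)
    (ιs : (s : ℕ) → Finset (SdT (Fin n → V) s) → SdT (Fin n → V) s)
    (hι : ∀ r, GoodIota K n r ιs) (r k : ℕ) (hSC : SCle K n r ιs k) :
    TCSigma n ↥(K.realization) ≤ (k : ℕ∞) := by
  obtain ⟨L, hLM, hcov, hinv, hsym⟩ := hSC
  set H : (Fin n → ↥(K.realization)) → SdT (Fin n → V) r → ℝ :=
    fun x => secR (secP fun j => (x j).1) r with hH
  have hP : ∀ x : Fin n → ↥(K.realization), (secP fun j => (x j).1) ∈ (powC K n).realization :=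
    fun x => secP_mem hord (by omega) fun j => (x j).2
  have hHm : ∀ x, H x ∈ (CIter (powC K n) r).realization := fun x => secR_mem (hP x) r
  have hHs : ∀ x, ∑ v, H x v = 1 := fun x => (hHm x).2.1
  have hHc : Continuous H :=
    (continuous_secR r).comp (continuous_secP.comp (by fun_prop))
  have hHg : ∀ (g : Equiv.Perm (Fin n)) x v,
      H (fun j => x (g j)) (SdMap (Fin n → V) (pAct g) r v) = H x v := by
    intro g x v
    exact secR_equiv (pAct_bij g) (fun w => secP_equiv g (fun j => (x j).1) w) r v
  have hbij : ∀ g : Equiv.Perm (Fin n), Function.Bijective (SdMap (Fin n → V) (pAct g) r) :=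
    fun g => sdMap_bij (pAct_bij g) r
  have hHx : ∀ x j, realizeMap (fun w : Fin n → V => w j) (iterReal (Fin n → V) r (H x))
      = (x j).1 := by
    intro x j
    rw [hH]
    dsimp only
    rw [iterReal_secR (hP x), realizeMap_secP hord fun j => (x j).2]
  have hstar : ∀ x j v, H x v ≠ 0 → (x j).1 (compIota ιs r v j) ≠ 0 := by
    intro x j v hv
    have h1 := compIota_star hι r (hHm x) v hv
    have hm := iterReal_mem r (hHm x)
    rw [← hHx x j]
    unfold realizeMap
    refine (lt_of_lt_of_le (lt_of_le_of_ne (hm.1 _) h1.symm)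
      (Finset.single_le_sum (f := fun v => iterReal (Fin n → V) r (H x) v)
        (fun i _ => hm.1 i) ?_)).ne'
    simp
  refine sInf_le ⟨k, rfl, fun i => {x | bigS (H x) ∈ (L i).faces}, ?_, ?_, ?_, ?_⟩
  · exact fun i => bigS_open H hHc hHs (L i)
  · intro x
    exact hcov _ (bigS_face (hHm x))
  · intro i g x hx
    change bigS (H fun j => x (g j)) ∈ (L i).faces
    rw [bigS_equiv (hbij g) (hHg g x)]
    exact hinv i g _ hx
  · intro i
    obtain ⟨-, c, φ, hc0, hφ0, -, hφc, hφ1, hφg⟩ := hsym i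
    have hmem : ∀ j l, l ≤ c → ∀ x, bigS (H x) ∈ (L i).faces →
        (bigS (H x)).image (φ j l) ∈ K.faces := by
      intro j l hl x hx
      rcases Nat.lt_or_ge l c with h | h
      · exact (hφ1 j l h).1 _ hx
      · obtain rfl : l = c := le_antisymm hl h
        obtain ⟨l', rfl⟩ : ∃ l', l = l' + 1 := ⟨l - 1, by omega⟩
        exact (hφ1 j l' (by omega)).2.1 _ hx
    have hreal : ∀ j l, l ≤ c → ∀ x, bigS (H x) ∈ (L i).faces →
        realizeMap (φ j l) (trim (H x)) ∈ K.realization := by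
      intro j l hl x hx
      exact realizeMap_mem (trim_nonneg _) (trim_sum (hHs x)) (hmem j l hl x hx)
        fun v hv => Finset.mem_image_of_mem _ (trim_supp hv)
    have hrs : ∀ j l x w, realizeMap (φ j l) (trim (H x)) w ≠ 0 →
        ∃ v ∈ bigS (H x), φ j l v = w := by
      intro j l x w hw
      obtain ⟨v, hv, hv'⟩ := Finset.exists_ne_zero_of_sum_ne_zero hw
      exact ⟨v, trim_supp hv', by simpa using hv⟩
    refine exists_planner _ (bigS_open H hHc hHs (L i))
      (fun j l x => if l ≤ c then realizeMap (φ j l) (trim (H x)) else (x j).1) (c + 1)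
      (Nat.succ_pos c) ?_ ?_ ?_ ?_ ?_
    · intro j l
      apply Continuous.continuousOn
      by_cases hl : l ≤ c
      · simp only [hl, if_true]
        exact (continuous_realizeMap _).comp (continuous_trim H hHc hHs)
      · simp only [hl, if_false]
        fun_prop
    · intro j l hl x hx s hs0 hs1
      have hl' : l ≤ c := by omega
      simp only [hl', if_true]
      rcases Nat.lt_or_ge l c with h | h
      · rw [if_pos (by omega)]
        refine segment_mem (hreal j l hl' x hx) (hreal j (l + 1) h x hx)
          ((hφ1 j l h).2.2 _ hx) ?_ ?_ hs0 hs1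
        · intro w hw
          obtain ⟨v, hv, rfl⟩ := hrs j l x w hw
          exact Finset.mem_union_left _ (Finset.mem_image_of_mem _ hv)
        · intro w hw
          obtain ⟨v, hv, rfl⟩ := hrs j (l + 1) x w hw
          exact Finset.mem_union_right _ (Finset.mem_image_of_mem _ hv)
      · obtain rfl : l = c := le_antisymm hl' h
        rw [if_neg (by omega)]
        refine segment_mem (hreal j l hl' x hx) (x j).2 (real_supp_face (x j).2) ?_ ?_ hs0 hs1
        · intro w hw
          obtain ⟨v, hv, rfl⟩ := hrs j l x w hw
          rw [hφc]
          simpa using hstar x j v (bigS_supp hv)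
        · intro w hw
          simpa using hw
    · intro j j'
      funext x
      simp only [Nat.zero_le, if_true]
      rw [hφ0 j j']
    · intro j x
      simp
    · intro g x hx j l _
      by_cases hl : l ≤ c
      · simp only [hl, if_true]
        refine realizeMap_equiv (hbij g) (trim_equiv (hbij g) (hHg g x)) fun v hv => ?_
        refine hφg j l g v ?_ hl
        exact (L i).down_closed hx (by simpa using trim_supp hv) (Finset.singleton_nonempty v)
      · simp only [hl, if_false]

/-! ### Positions of the vertices of `sd^r(K^n)` in `|K|^n` -/

def dl {W : Type u} (x : W) : W → ℝ := fun y => if y = x then 1 else 0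

lemma dl_mem {W : Type u} [Fintype W] {K : ASC W} {x : W} (h : vertexOf K x) :
    dl x ∈ K.realization := by
  refine ⟨fun v => ?_, by simp [dl], {x}, h, fun v hv => ?_⟩
  · unfold dl; split_ifs <;> norm_num
  · by_contra hh
    exact hv (by simp [dl, (by simpa using hh : v ≠ x)])

lemma stepReal_sum {W ι : Type*} [Fintype W] (s : Finset ι) (c : ι → ℝ) (B : ι → Finset W → ℝ) :
    stepReal W (fun y => ∑ i ∈ s, c i * B i y) = fun w => ∑ i ∈ s, c i * stepReal W (B i) w := by
  funext w
  unfold stepReal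
  simp only [Finset.sum_mul, Finset.mul_sum]
  rw [Finset.sum_comm]
  refine Finset.sum_congr rfl fun i _ => Finset.sum_congr rfl fun σ _ => ?_
  ring

lemma iterReal_sum {V' ι : Type*} [Fintype V'] (r : ℕ) (s : Finset ι) (c : ι → ℝ)
    (B : ι → SdT V' r → ℝ) :
    iterReal V' r (fun y => ∑ i ∈ s, c i * B i y) =
      fun w => ∑ i ∈ s, c i * iterReal V' r (B i) w := by
  induction r with
  | zero => rfl
  | succ r ih =>
    change iterReal V' r (stepReal (SdT V' r) _) = _
    exact (congrArg _ (stepReal_sum s c B)).trans (ih _)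

lemma realizeMap_sum {W V ι : Type*} [Fintype W] (p : W → V) (s : Finset ι) (c : ι → ℝ)
    (B : ι → W → ℝ) :
    realizeMap p (fun y => ∑ i ∈ s, c i * B i y) =
      fun w => ∑ i ∈ s, c i * realizeMap p (B i) w := by
  funext w
  unfold realizeMap
  simp only [Finset.mul_sum]
  rw [Finset.sum_comm]

lemma stepReal_dl {W : Type u} [Fintype W] (σ : Finset W) :
    stepReal W (dl σ) = fun y => ∑ x ∈ σ, (σ.card : ℝ)⁻¹ * dl x y := by
  funext y
  unfold stepReal dl
  rw [Finset.sum_eq_single σ (fun τ _ h => by simp [h]) (by simp)]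
  simp

def posV {V : Type u} [Fintype V] {n : ℕ} (r : ℕ) (x : SdT (Fin n → V) r) (j : Fin n) : V → ℝ :=
  realizeMap (fun w : Fin n → V => w j) (iterReal (Fin n → V) r (dl x))

lemma posV_succ {V : Type u} [Fintype V] {n : ℕ} (r : ℕ) (σ : Finset (SdT (Fin n → V) r))
    (j : Fin n) (v : V) :
    posV (r + 1) σ j v = ∑ x ∈ σ, (σ.card : ℝ)⁻¹ * posV r x j v := by
  have h1 : iterReal (Fin n → V) (r + 1) (dl σ) =
      fun w => ∑ x ∈ σ, (σ.card : ℝ)⁻¹ * iterReal (Fin n → V) r (dl x) w :=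
    (congrArg _ (stepReal_dl σ)).trans (iterReal_sum r σ _ _)
  unfold posV
  rw [h1, realizeMap_sum]

lemma posV_mem {V : Type u} [Fintype V] [PartialOrder V] {K : ASC V} {n : ℕ} {r : ℕ}
    {x : SdT (Fin n → V) r} (h : vertexOf (CIter (powC K n) r) x) (j : Fin n) :
    posV r x j ∈ K.realization :=
  proj_mem (iterReal_mem r (dl_mem h)) j

lemma vertexOf_of_mem {W : Type u} {K : ASC W} {σ : Finset W} (hσ : σ ∈ K.faces) {x : W}
    (hx : x ∈ σ) : vertexOf K x :=
  K.down_closed hσ (by simpa using hx) (Finset.singleton_nonempty x)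

lemma vertexOf_sd {W : Type u} {K : ASC W} {σ : Finset W} (hσ : σ ∈ K.faces) :
    vertexOf (sdC K) σ := by
  refine ⟨Finset.singleton_nonempty σ, fun τ hτ => ?_, ?_⟩
  · rw [Finset.mem_singleton.mp hτ]; exact hσ
  · simp

lemma bary_mem {V : Type u} [Fintype V] [PartialOrder V] {K : ASC V} {n : ℕ} {r : ℕ}
    {σ : Finset (SdT (Fin n → V) r)} (hσ : σ ∈ (CIter (powC K n) r).faces) (j : Fin n) :
    posV (r + 1) σ j ∈ K.realization :=
  posV_mem (r := r + 1) (vertexOf_sd hσ) j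

lemma bary_supp {V : Type u} [Fintype V] [PartialOrder V] {K : ASC V} {n : ℕ} {r : ℕ}
    {σ : Finset (SdT (Fin n → V) r)} (hσ : σ ∈ (CIter (powC K n) r).faces) (j : Fin n)
    {x : SdT (Fin n → V) r} (hx : x ∈ σ) {v : V} (hv : posV r x j v ≠ 0) :
    posV (r + 1) σ j v ≠ 0 := by
  rw [posV_succ]
  have hnn : ∀ y ∈ σ, 0 ≤ posV r y j v := fun y hy => (posV_mem (vertexOf_of_mem hσ hy) j).1 v
  have hc : 0 < (σ.card : ℝ) := by exact_mod_cast Finset.card_pos.mpr ⟨x, hx⟩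
  refine (Finset.sum_pos' (fun y hy => mul_nonneg (by positivity) (hnn y hy)) ⟨x, hx, ?_⟩).ne'
  exact mul_pos (by positivity) (lt_of_le_of_ne (hnn x hx) hv.symm)

lemma posV_equiv {V : Type u} [Fintype V] {n : ℕ} (r : ℕ) (g : Equiv.Perm (Fin n))
    (x : SdT (Fin n → V) r) (j : Fin n) :
    posV r (SdMap (Fin n → V) (pAct g) r x) j = posV r x (g j) := by
  unfold posV
  refine realizeMap_equiv (pAct_bij g) (iterReal_equiv (pAct_bij g) r fun y => ?_)
    fun _ _ => rfl
  simp [dl, (sdMap_bij (pAct_bij g) r).1.eq_iff]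

lemma compIota_pos {V : Type u} [Fintype V] [PartialOrder V] {K : ASC V} {n : ℕ}
    {ιs : (s : ℕ) → Finset (SdT (Fin n → V) s) → SdT (Fin n → V) s}
    (hι : ∀ r, GoodIota K n r ιs) {r : ℕ} {x : SdT (Fin n → V) r}
    (hx : vertexOf (CIter (powC K n) r) x) (j : Fin n) :
    posV r x j (compIota ιs r x j) ≠ 0 := by
  have h1 := compIota_star hι r (dl_mem hx) x (by simp [dl])
  have hm := iterReal_mem r (dl_mem hx)
  unfold posV realizeMap
  refine (lt_of_lt_of_le (lt_of_le_of_ne (hm.1 _) h1.symm)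
    (Finset.single_le_sum (f := fun v => iterReal (Fin n → V) r (dl x) v)
      (fun i _ => hm.1 i) ?_)).ne'
  simp

/-! ### Mesh of the iterated subdivisions -/

lemma face_card {V' : Type u} [Fintype V'] (K : ASC V') (r : ℕ) :
    ∀ σ ∈ (CIter K r).faces, σ.card ≤ Fintype.card V' := by
  induction r with
  | zero => intro σ _; exact Finset.card_le_univ σ
  | succ r ih =>
    rintro c ⟨-, h2, h3⟩
    have : (Finset.Icc 1 (Fintype.card V')).card = Fintype.card V' := by simp
    rw [← this]
    refine Finset.card_le_card_of_injOn (fun σ : Finset (SdT V' r) => σ.card) ?_ ?_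
    · intro σ hσ
      simp only [Finset.coe_Icc, Set.mem_Icc]
      exact ⟨Finset.card_pos.mpr ((CIter K r).nonempty_of_mem (h2 σ hσ)), ih σ (h2 σ hσ)⟩
    · intro σ hσ τ hτ h
      rcases h3.total hσ hτ with hh | hh
      · exact Finset.eq_of_subset_of_card_le hh h.ge
      · exact (Finset.eq_of_subset_of_card_le hh h.le).symm

lemma mean_sub {W E : Type*} [NormedAddCommGroup E] [NormedSpace ℝ E] (q : W → E) (D N : ℝ)
    (hD : 0 ≤ D) (τ : Finset W) (hN : (τ.card : ℝ) ≤ N)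
    (hq : ∀ a ∈ τ, ∀ b ∈ τ, ‖q a - q b‖ ≤ D) (a : W) (ha : a ∈ τ) :
    ‖q a - (τ.card : ℝ)⁻¹ • ∑ b ∈ τ, q b‖ ≤ (1 - N⁻¹) * D := by
  have hc : 0 < (τ.card : ℝ) := by exact_mod_cast Finset.card_pos.mpr ⟨a, ha⟩
  have h1 : q a - (τ.card : ℝ)⁻¹ • ∑ b ∈ τ, q b = (τ.card : ℝ)⁻¹ • ∑ b ∈ τ, (q a - q b) := by
    rw [Finset.sum_sub_distrib, smul_sub, Finset.sum_const, ← Nat.cast_smul_eq_nsmul ℝ, smul_smul,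
      inv_mul_cancel₀ hc.ne', one_smul]
  have h2 : ‖∑ b ∈ τ, (q a - q b)‖ ≤ ((τ.card : ℝ) - 1) * D := by
    rw [← Finset.add_sum_erase _ _ ha, sub_self, zero_add]
    refine (norm_sum_le_of_le _ fun b hb => hq a ha b (Finset.mem_of_mem_erase hb)).trans ?_
    rw [Finset.sum_const, nsmul_eq_mul, Finset.card_erase_of_mem ha,
      Nat.cast_sub (Finset.card_pos.mpr ⟨a, ha⟩), Nat.cast_one]
  rw [h1, norm_smul, Real.norm_of_nonneg (by positivity)]
  calc (τ.card : ℝ)⁻¹ * ‖∑ b ∈ τ, (q a - q b)‖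
      ≤ (τ.card : ℝ)⁻¹ * (((τ.card : ℝ) - 1) * D) := by gcongr
    _ = (1 - (τ.card : ℝ)⁻¹) * D := by field_simp
    _ ≤ (1 - N⁻¹) * D := by gcongr

lemma mean_sub_mean {W E : Type*} [NormedAddCommGroup E] [NormedSpace ℝ E] (q : W → E) (D N : ℝ)
    (hD : 0 ≤ D) (σ τ : Finset W) (hσ : σ.Nonempty) (hst : σ ⊆ τ) (hN : (τ.card : ℝ) ≤ N)
    (hq : ∀ a ∈ τ, ∀ b ∈ τ, ‖q a - q b‖ ≤ D) :
    ‖(σ.card : ℝ)⁻¹ • ∑ a ∈ σ, q a - (τ.card : ℝ)⁻¹ • ∑ b ∈ τ, q b‖ ≤ (1 - N⁻¹) * D := by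
  have hc : 0 < (σ.card : ℝ) := by exact_mod_cast Finset.card_pos.mpr hσ
  set m := (τ.card : ℝ)⁻¹ • ∑ b ∈ τ, q b with hm
  have h1 : (σ.card : ℝ)⁻¹ • ∑ a ∈ σ, q a - m = (σ.card : ℝ)⁻¹ • ∑ a ∈ σ, (q a - m) := by
    rw [Finset.sum_sub_distrib, smul_sub, Finset.sum_const, ← Nat.cast_smul_eq_nsmul ℝ, smul_smul,
      inv_mul_cancel₀ hc.ne', one_smul]
  have h2 : ‖∑ a ∈ σ, (q a - m)‖ ≤ (σ.card : ℝ) * ((1 - N⁻¹) * D) := by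
    refine (norm_sum_le_of_le _ fun a ha => mean_sub q D N hD τ hN hq a (hst ha)).trans ?_
    rw [Finset.sum_const, nsmul_eq_mul]
  rw [h1, norm_smul, Real.norm_of_nonneg (by positivity)]
  calc (σ.card : ℝ)⁻¹ * ‖∑ a ∈ σ, (q a - m)‖
      ≤ (σ.card : ℝ)⁻¹ * ((σ.card : ℝ) * ((1 - N⁻¹) * D)) := by gcongr
    _ = (1 - N⁻¹) * D := by field_simp

lemma mesh_bound {V' : Type u} [Fintype V'] (K : ASC V') {E : Type*} [NormedAddCommGroup E]
    [NormedSpace ℝ E] (q : (r : ℕ) → SdT V' r → E)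
    (hq : ∀ r (σ : Finset (SdT V' r)), q (r + 1) σ = (σ.card : ℝ)⁻¹ • ∑ x ∈ σ, q r x)
    (D : ℝ) (hD : 0 ≤ D) (h0 : ∀ a b : V', ‖q 0 a - q 0 b‖ ≤ D) (r : ℕ) :
    ∀ σ ∈ (CIter K r).faces, ∀ x ∈ σ, ∀ y ∈ σ,
      ‖q r x - q r y‖ ≤ (1 - ((Fintype.card V' : ℝ) + 1)⁻¹) ^ r * D := by
  have hN : (0 : ℝ) ≤ 1 - ((Fintype.card V' : ℝ) + 1)⁻¹ := by
    rw [sub_nonneg]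
    apply inv_le_one_of_one_le₀
    have : (0 : ℝ) ≤ Fintype.card V' := Nat.cast_nonneg _
    linarith
  induction r with
  | zero => intro σ _ x _ y _; simpa using h0 x y
  | succ r ih =>
    rintro c ⟨-, h2, h3⟩
    have key : ∀ σ ∈ (CIter K r).faces, ∀ τ ∈ (CIter K r).faces, σ ⊆ τ →
        ‖q (r + 1) σ - q (r + 1) τ‖ ≤ (1 - ((Fintype.card V' : ℝ) + 1)⁻¹) ^ (r + 1) * D := by
      intro σ hσ τ hτ hst
      rw [hq, hq, pow_succ', mul_assoc]
      refine mean_sub_mean (q r) _ _ (by positivity) σ τ ((CIter K r).nonempty_of_mem hσ) hst ?_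
        (ih τ hτ)
      have : (τ.card : ℝ) ≤ Fintype.card V' := by exact_mod_cast face_card K r τ hτ
      linarith
    intro σ hσ τ hτ
    rcases h3.total hσ hτ with hh | hh
    · exact key σ (h2 σ hσ) τ (h2 τ hτ) hh
    · rw [norm_sub_rev]; exact key τ (h2 τ hτ) σ (h2 σ hσ) hh

lemma mesh_small {V : Type u} [Fintype V] [PartialOrder V] (K : ASC V) (n : ℕ) (ε : ℝ)
    (hε : 0 < ε) : ∀ᶠ r in Filter.atTop, ∀ σ ∈ (CIter (powC K n) r).faces, ∀ x ∈ σ, ∀ y ∈ σ,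
      dist (posV r x) (posV r y) < ε := by
  obtain ⟨D, hD⟩ := (Set.finite_range fun p : (Fin n → V) × (Fin n → V) =>
    ‖posV 0 p.1 - posV 0 p.2‖).bddAbove
  have hD' : ∀ a b : Fin n → V, ‖posV 0 a - posV 0 b‖ ≤ max D 0 := fun a b =>
    (hD (Set.mem_range_self (a, b))).trans (le_max_left _ _)
  have hb := mesh_bound (powC K n) (fun r x => posV r x) (fun r σ => by
    funext j v
    rw [posV_succ]
    simp [Finset.mul_sum]) (max D 0) (le_max_right _ _) hD'
  have ht : Filter.Tendsto (fun r : ℕ => (1 - ((Fintype.card (Fin n → V) : ℝ) + 1)⁻¹) ^ r *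
      max D 0) Filter.atTop (nhds (0 * max D 0)) := by
    refine Filter.Tendsto.mul_const _ (tendsto_pow_atTop_nhds_zero_of_lt_one ?_ ?_)
    · rw [sub_nonneg]
      apply inv_le_one_of_one_le₀
      have : (0 : ℝ) ≤ Fintype.card (Fin n → V) := Nat.cast_nonneg _
      linarith
    · have : (0 : ℝ) < ((Fintype.card (Fin n → V) : ℝ) + 1)⁻¹ := by positivity
      linarith
  rw [zero_mul] at ht
  filter_upwards [ht.eventually (gt_mem_nhds hε)] with r hr σ hσ x hx y hy
  rw [dist_eq_norm]
  exact (hb r σ hσ x hx y hy).trans_lt hr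

/-! ### Selecting a vertex with large weight -/

def selV {V : Type u} [Fintype V] {K : ASC V} (α : ↥(K.realization)) : V :=
  (exists_big α.2.2.1).choose

lemma selV_spec {V : Type u} [Fintype V] {K : ASC V} (α : ↥(K.realization)) :
    ((Fintype.card V : ℝ) + 1)⁻¹ < α.1 (selV α) := (exists_big α.2.2.1).choose_spec

lemma selV_ne {V : Type u} [Fintype V] {K : ASC V} (α : ↥(K.realization)) :
    α.1 (selV α) ≠ 0 := by
  have : 0 < ((Fintype.card V : ℝ) + 1)⁻¹ := by positivity
  exact (this.trans (selV_spec α)).ne'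

lemma selV_near {V : Type u} [Fintype V] {K : ASC V} (α β : ↥(K.realization))
    (h : dist α β < ((Fintype.card V : ℝ) + 1)⁻¹) : β.1 (selV α) ≠ 0 := by
  have h1 := selV_spec α
  have h2 : |α.1 (selV α) - β.1 (selV α)| ≤ dist α β := by
    rw [Subtype.dist_eq, ← Real.dist_eq]
    exact dist_le_pi_dist _ _ _
  have h3 := le_abs_self (α.1 (selV α) - β.1 (selV α))
  intro h0
  rw [h0] at h2 h3
  linarith

lemma oneCont_of_union {V : Type u} {W : Type v} {K : ASC V} {L : ASC W} {f g : V → W}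
    (h : ∀ σ ∈ K.faces, σ.image f ∪ σ.image g ∈ L.faces) : OneCont K L f g :=
  ⟨fun σ hσ => L.down_closed (h σ hσ) Finset.subset_union_left ((K.nonempty_of_mem hσ).image _),
   fun σ hσ => L.down_closed (h σ hσ) Finset.subset_union_right ((K.nonempty_of_mem hσ).image _),
   h⟩

lemma continuous_arm (n : ℕ) (j : Fin n) : Continuous (arm n j) := by
  have : Continuous (Quotient.mk (wedgeSetoid n)) := continuous_quotient_mk'
  exact this.comp (f := fun t : unitInterval => (j, t)) (by fun_prop)

lemma arm_zero (n : ℕ) (j j' : Fin n) : arm n j 0 = arm n j' 0 :=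
  Quotient.sound (s := wedgeSetoid n) (Or.inr ⟨rfl, rfl⟩)

set_option maxHeartbeats 2000000 in
theorem SCle_of_cover {V : Type u} [Fintype V] [PartialOrder V] (K : ASC V)
    (n : ℕ) (hn : 2 ≤ n)
    (ιs : (s : ℕ) → Finset (SdT (Fin n → V) s) → SdT (Fin n → V) s)
    (hι : ∀ r, GoodIota K n r ιs) (k : ℕ)
    (U : Fin k → Set (Fin n → ↥(K.realization)))
    (hUo : ∀ i, IsOpen (U i))
    (hUc : ∀ x, ∃ i, x ∈ U i)
    (hUg : ∀ i (g : Equiv.Perm (Fin n)), ∀ x ∈ U i, (fun j => x (g j)) ∈ U i)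
    (hUs : ∀ i, ∃ s : C(↥(U i), C(WedgeI n, ↥(K.realization))),
        (∀ (x : ↥(U i)) (j : Fin n), (s x) (arm n j 1) = x.1 j) ∧
        ∀ (g : Equiv.Perm (Fin n)) (x : Fin n → ↥(K.realization)) (hx : x ∈ U i)
          (hgx : (fun j => x (g j)) ∈ U i) (t : unitInterval) (j : Fin n),
          (s ⟨fun j => x (g j), hgx⟩) (arm n j t) = (s ⟨x, hx⟩) (arm n (g j) t)) :
    ∃ r, SCle K n r ιs k := by
  have hVne : Nonempty V := ⟨(ιs 0 (∅ : Finset (Fin n → V)) : Fin n → V) ⟨0, by omega⟩⟩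
  obtain ⟨δ, hδ, hleb⟩ := lebesgue_number_lemma_of_metric
    (isCompact_univ (X := Fin n → ↥(K.realization))) hUo
    (fun x _ => Set.mem_iUnion.mpr (hUc x))
  choose s hs1 hsg using hUs
  -- the closed shrinkings
  let C : Fin k → Set (Fin n → ↥(K.realization)) := fun i => {x | ∀ y, dist x y < δ / 2 → y ∈ U i}
  have hCU : ∀ i, C i ⊆ U i := fun i x hx => hx x (by rw [dist_self]; linarith)
  have hCcl : ∀ i, IsClosed (C i) := by
    intro i
    rw [← isOpen_compl_iff, isOpen_iff_mem_nhds]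
    intro x hx
    have : ∃ y, dist x y < δ / 2 ∧ y ∉ U i := by
      by_contra! hh
      exact hx hh
    obtain ⟨y, hy, hyU⟩ := this
    have hev : ∀ᶠ z in nhds x, dist z y < δ / 2 :=
      (continuous_id.dist continuous_const).continuousAt.eventually_lt continuousAt_const hy
    filter_upwards [hev] with z hz hzC
    exact hyU (hzC y hz)
  have hCg : ∀ i (g : Equiv.Perm (Fin n)), ∀ x ∈ C i, (fun j => x (g j)) ∈ C i := by
    intro i g x hx y hy
    have h1 : (fun j => y (g.symm j)) ∈ U i := by
      apply hx
      rw [dist_pi_lt_iff (by linarith)] at hy ⊢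
      intro j
      simpa using hy (g.symm j)
    simpa using hUg i g _ h1
  -- the homotopies
  let H : (i : Fin k) → Fin n → ↥(C i) × unitInterval → ↥(K.realization) :=
    fun i j p => s i ⟨p.1.1, hCU i p.1.2⟩ (arm n j p.2)
  have hHc : ∀ i j, Continuous (H i j) := by
    intro i j
    let A : C(unitInterval, WedgeI n) := ⟨arm n j, continuous_arm n j⟩
    have h1 : Continuous fun x : ↥(C i) => (s i ⟨x.1, hCU i x.2⟩).comp A :=
      (ContinuousMap.continuous_precomp A).comp ((s i).continuous.comp (by fun_prop))
    have h2 : Continuous fun p : ↥(C i) × unitInterval =>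
        ((s i ⟨p.1.1, hCU i p.1.2⟩).comp A) p.2 :=
      (h1.comp continuous_fst).eval continuous_snd
    exact h2
  have hη : ∀ i, ∃ η > 0, ∀ p q : ↥(C i) × unitInterval, dist p q < η → ∀ j,
      dist (H i j p) (H i j q) < ((Fintype.card V : ℝ) + 1)⁻¹ := by
    intro i
    have : CompactSpace ↥(C i) := isCompact_iff_compactSpace.mp (hCcl i).isCompact
    have hc : Continuous fun p j => H i j p := continuous_pi (hHc i)
    have hpos : 0 < ((Fintype.card V : ℝ) + 1)⁻¹ := by positivity
    obtain ⟨η, hη, h⟩ := Metric.uniformContinuous_iff.mp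
      (CompactSpace.uniformContinuous_of_continuous hc) _ hpos
    exact ⟨η, hη, fun p q hpq j => (dist_le_pi_dist _ _ j).trans_lt (h hpq)⟩
  choose η hη0 hη using hη
  -- the subdivision level
  have hev : ∀ᶠ r in Filter.atTop, (∀ i, ∀ σ ∈ (CIter (powC K n) r).faces, ∀ x ∈ σ, ∀ y ∈ σ,
      dist (posV r x) (posV r y) < η i) ∧ (∀ σ ∈ (CIter (powC K n) r).faces, ∀ x ∈ σ, ∀ y ∈ σ,
      dist (posV r x) (posV r y) < δ / 2) :=
    (Filter.eventually_all.mpr fun i => mesh_small K n (η i) (hη0 i)).and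
      (mesh_small K n (δ / 2) (by linarith))
  obtain ⟨r, hrη, hrδ⟩ := hev.exists
  set M := CIter (powC K n) r with hM
  let pt : (x : SdT (Fin n → V) r) → vertexOf M x → Fin n → ↥(K.realization) :=
    fun x hx j => ⟨posV r x j, posV_mem hx j⟩
  have hptd : ∀ x hx y hy, dist (pt x hx) (pt y hy) = dist (posV r x) (posV r y) := by
    intro x hx y hy
    rw [dist_pi_def, dist_pi_def]
    rfl
  have hMg : ∀ g : Equiv.Perm (Fin n), ∀ σ ∈ M.faces,
      σ.image (SdMap (Fin n → V) (pAct g) r) ∈ M.faces := fun g => cIter_inv (fun σ hσ => by convert powC_inv g σ hσ) r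
  have hvg : ∀ (g : Equiv.Perm (Fin n)) x, vertexOf M x →
      vertexOf M (SdMap (Fin n → V) (pAct g) r x) := by
    intro g x hx
    have := hMg g _ hx
    rwa [Finset.image_singleton] at this
  have hptg : ∀ (g : Equiv.Perm (Fin n)) x hx hgx,
      pt (SdMap (Fin n → V) (pAct g) r x) hgx = fun j => pt x hx (g j) := by
    intro g x hx hgx
    funext j
    exact Subtype.ext (posV_equiv r g x j)
  let inC : Fin k → SdT (Fin n → V) r → Prop := fun i x => ∃ hx : vertexOf M x, pt x hx ∈ C i
  have hinCg : ∀ i (g : Equiv.Perm (Fin n)) x, inC i x →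
      inC i (SdMap (Fin n → V) (pAct g) r x) := by
    rintro i g x ⟨hx, hxC⟩
    refine ⟨hvg g x hx, ?_⟩
    rw [hptg g x hx (hvg g x hx)]
    exact hCg i g _ hxC
  let L : Fin k → ASC (SdT (Fin n → V) r) := fun i =>
    { faces := {σ | σ ∈ M.faces ∧ ∀ x ∈ σ, inC i x}
      nonempty_of_mem := fun h => M.nonempty_of_mem h.1
      down_closed := fun h hsub hne => ⟨M.down_closed h.1 hsub hne, fun x hx => h.2 x (hsub hx)⟩ }
  refine ⟨r, L, fun i σ hσ => hσ.1, ?_, ?_, ?_⟩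
  · intro σ hσ
    obtain ⟨x, hx⟩ := M.nonempty_of_mem hσ
    obtain ⟨i, hi⟩ := hleb (pt x (vertexOf_of_mem hσ hx)) (Set.mem_univ _)
    refine ⟨i, hσ, fun y hy => ⟨vertexOf_of_mem hσ hy, fun z hz => hi ?_⟩⟩
    have h1 := hrδ σ hσ y hy x hx
    rw [← hptd y (vertexOf_of_mem hσ hy) x (vertexOf_of_mem hσ hx)] at h1
    rw [Metric.mem_ball]
    have := dist_triangle_left z (pt x (vertexOf_of_mem hσ hx)) (pt y (vertexOf_of_mem hσ hy))
    linarith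
  · intro i g σ hσ
    refine ⟨hMg g σ hσ.1, fun y hy => ?_⟩
    rw [Finset.mem_image] at hy
    obtain ⟨x, hx, rfl⟩ := hy
    exact hinCg i g x (hσ.2 x hx)
  · intro i
    have hvL : ∀ v, vertexOf (L i) v → inC i v := fun v hv =>
      hv.2 v (Finset.mem_singleton_self v)
    obtain ⟨c0, hc0⟩ := exists_nat_one_div_lt (hη0 i)
    set c := c0 + 1 with hcdef
    have hcpos : (0 : ℝ) < c := by rw [hcdef]; positivity
    have hcη : 1 / (c : ℝ) < η i := by rw [hcdef]; exact_mod_cast hc0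
    let τ : ℕ → unitInterval := fun l => Set.projIcc 0 1 zero_le_one ((l : ℝ) / c)
    have hτ0 : τ 0 = 0 := by
      change Set.projIcc 0 1 zero_le_one (((0 : ℕ) : ℝ) / c) = 0
      rw [Nat.cast_zero, zero_div]
      exact Set.projIcc_left _
    have hτc : τ c = 1 := by
      change Set.projIcc 0 1 zero_le_one ((c : ℝ) / c) = 1
      rw [div_self hcpos.ne']
      exact Set.projIcc_right _
    have hτd : ∀ l, dist (τ l) (τ (l + 1)) < η i := by
      intro l
      have h1 := (LipschitzWith.projIcc (zero_le_one (α := ℝ))).dist_le_mul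
        ((l : ℝ) / c) (((l + 1 : ℕ) : ℝ) / c)
      refine h1.trans_lt ?_
      rw [NNReal.coe_one, one_mul, Real.dist_eq]
      have : (l : ℝ) / c - ((l + 1 : ℕ) : ℝ) / c = - (1 / c) := by
        push_cast; field_simp; ring
      rw [this, abs_neg, abs_of_pos (by positivity)]
      exact hcη
    let ψ : Fin n → ℕ → SdT (Fin n → V) r → V := fun j l x =>
      if h : inC i x then selV (H i j (⟨pt x h.1, h.2⟩, τ l)) else Classical.arbitrary V
    have hψ : ∀ j l x (h : inC i x), ψ j l x = selV (H i j (⟨pt x h.1, h.2⟩, τ l)) :=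
      fun j l x h => dif_pos h
    let φ : Fin n → ℕ → SdT (Fin n → V) r → V := fun j l x =>
      if l ≤ c then ψ j l x else compIota ιs r x j
    have hφ1 : ∀ j l, l ≤ c → φ j l = ψ j l := fun j l h => funext fun x => if_pos h
    have hφ2 : ∀ j l, ¬ l ≤ c → φ j l = fun x => compIota ιs r x j :=
      fun j l h => funext fun x => if_neg h
    have hψg : ∀ j l (g : Equiv.Perm (Fin n)) x, inC i x →
        ψ j l (SdMap (Fin n → V) (pAct g) r x) = ψ (g j) l x := by
      intro j l g x hx
      rw [hψ j l _ (hinCg i g x hx), hψ (g j) l x hx]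
      congr 1
      have h1 := hsg i g (pt x hx.1) (hCU i hx.2) (hUg i g _ (hCU i hx.2)) (τ l) j
      refine Eq.trans ?_ h1
      change s i ⟨pt (SdMap (Fin n → V) (pAct g) r x) (hinCg i g x hx).1, hCU i (hinCg i g x hx).2⟩
        (arm n j (τ l)) = _
      congr 2
      exact Subtype.ext (hptg g x hx.1 (hinCg i g x hx).1)
    have hψ0 : ∀ j j', ψ j 0 = ψ j' 0 := by
      intro j j'
      funext x
      by_cases h : inC i x
      · rw [hψ j 0 x h, hψ j' 0 x h]
        congr 1
        change s i _ (arm n j (τ 0)) = s i _ (arm n j' (τ 0))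
        rw [hτ0, arm_zero n j j']
      · change dite _ _ _ = dite _ _ _
        rw [dif_neg h, dif_neg h]
    have hfg : ∀ (j : Fin n) (g : Equiv.Perm (Fin n)) (x : SdT (Fin n → V) r),
        compIota ιs r (SdMap (Fin n → V) (pAct g) r x) j = compIota ιs r x (g j) := by
      intro j g x
      rw [compIota_equiv hι]
      rfl
    refine ⟨fun j g x _ => hfg j g x, c + 1, φ, Nat.succ_pos c, ?_, ?_, ?_, ?_, ?_⟩
    · intro j j'
      rw [hφ1 j 0 (Nat.zero_le _), hφ1 j' 0 (Nat.zero_le _), hψ0 j j']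
    · intro j g x hx
      rw [hφ1 j 0 (Nat.zero_le _), hψg j 0 g x (hvL x hx), hψ0 (g j) j]
    · intro j
      exact hφ2 j (c + 1) (by omega)
    · intro j l hl
      apply oneCont_of_union
      intro σ hσ
      have hne : (σ.image (φ j l) ∪ σ.image (φ j (l + 1))).Nonempty :=
        (((L i).nonempty_of_mem hσ).image _).mono Finset.subset_union_left
      rcases Nat.lt_or_ge l c with hlc | hlc
      · rw [hφ1 j l hlc.le, hφ1 j (l + 1) hlc] at hne ⊢
        obtain ⟨x0, hx0⟩ := (L i).nonempty_of_mem hσ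
        have hx0C := hσ.2 x0 hx0
        have hd : ∀ x (hx : x ∈ σ), dist (⟨pt x (hσ.2 x hx).1, (hσ.2 x hx).2⟩ : ↥(C i))
            ⟨pt x0 hx0C.1, hx0C.2⟩ < η i := by
          intro x hx
          rw [Subtype.dist_eq, hptd x (hσ.2 x hx).1 x0 hx0C.1]
          exact hrη i σ hσ.1 x hx x0 hx0
        refine K.down_closed (real_supp_face (H i j (⟨pt x0 hx0C.1, hx0C.2⟩, τ l)).2) ?_ hne
        intro v hv
        simp only [Finset.mem_filter, Finset.mem_univ, true_and]
        rw [Finset.mem_union, Finset.mem_image, Finset.mem_image] at hv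
        rcases hv with ⟨x, hx, rfl⟩ | ⟨x, hx, rfl⟩
        · rw [hψ j l x (hσ.2 x hx)]
          apply selV_near
          apply hη i
          rw [Prod.dist_eq]
          exact max_lt (hd x hx) (by simpa using hη0 i)
        · rw [hψ j (l + 1) x (hσ.2 x hx)]
          apply selV_near
          apply hη i
          rw [Prod.dist_eq]
          exact max_lt (hd x hx) (by rw [dist_comm]; exact hτd l)
      · obtain rfl : l = c := by omega
        rw [hφ1 j c le_rfl, hφ2 j (c + 1) (by omega)] at hne ⊢
        refine K.down_closed (real_supp_face (bary_mem hσ.1 j)) ?_ hne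
        intro v hv
        simp only [Finset.mem_filter, Finset.mem_univ, true_and]
        rw [Finset.mem_union, Finset.mem_image, Finset.mem_image] at hv
        rcases hv with ⟨x, hx, rfl⟩ | ⟨x, hx, rfl⟩
        · apply bary_supp hσ.1 j hx
          rw [hψ j c x (hσ.2 x hx)]
          have h1 : H i j (⟨pt x (hσ.2 x hx).1, (hσ.2 x hx).2⟩, τ c) =
              pt x (hσ.2 x hx).1 j := by
            rw [hτc]
            exact hs1 i _ j
          rw [h1]
          exact selV_ne (pt x (hσ.2 x hx).1 j)
        · apply bary_supp hσ.1 j hx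
          exact compIota_pos hι (vertexOf_of_mem hσ.1 hx) j
    · intro j l g x hx hl
      by_cases hlc : l ≤ c
      · rw [hφ1 j l hlc, hφ1 (g j) l hlc]
        exact hψg j l g x (hvL x hx)
      · rw [hφ2 j l hlc, hφ2 (g j) l hlc]
        exact hfg j g x

/-- For a finite simplicial complex `K`, `SC^Σ_n(K) = TC^Σ_n(|K|)`. -/
theorem statement10 {V : Type*} [Fintype V] [PartialOrder V] (K : ASC V)
    (hord : ∀ σ ∈ K.faces, IsChain (· ≤ ·) (σ : Set V))
    (n : ℕ) (hn : 2 ≤ n)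
    (ιs : (s : ℕ) → Finset (SdT (Fin n → V) s) → SdT (Fin n → V) s)
    (hι : ∀ r, GoodIota K n r ιs) :
    sInf {v : ℕ∞ | ∃ r : ℕ, v = SCval K n r ιs} = TCSigma n ↥(K.realization) := by
  apply le_antisymm
  · unfold TCSigma
    refine le_sInf ?_
    rintro _ ⟨k, rfl, U, h1, h2, h3, h4⟩
    obtain ⟨r, hr⟩ := SCle_of_cover K n hn ιs hι k U h1 h2 h3 h4
    have e1 : sInf {v : ℕ∞ | ∃ r : ℕ, v = SCval K n r ιs} ≤ SCval K n r ιs := sInf_le ⟨r, rfl⟩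
    have e2 : SCval K n r ιs ≤ (k : ℕ∞) := sInf_le ⟨k, rfl, hr⟩
    exact e1.trans e2
  · refine le_sInf ?_
    rintro _ ⟨r, rfl⟩
    refine le_sInf ?_
    rintro _ ⟨k, rfl, hk⟩
    exact TC_le_of_SCle K hord n hn ιs hι r k hk
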